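/- Assume N = 3. Then there exists a \bar{𝔽}_p-subspace M of the isotypic space (ind_{KZ}^G σ)^{IZ, χ_σ} = {f ∈ ind_{KZ}^G σ : i·f = χ_σ(i) f for all i ∈ I} such that: M ≠ 0; M is stable under the operator f ↦ f|T_{ν t_b} for every ν ∈ W(χ_σ) and every b ∈ ℤ²; and the quotient space (ind_{KZ}^G σ)^{IZ, χ_σ}/M is infinite-dimensional over \bar{𝔽}_p. -/

import Mathlib

open Matrix

noncomputable section

namespace IH

variable (p : ℕ) [Fact p.Prime]

/-- `\bar{𝔽}_p`, an algebraic closure of the residue field. -/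
abbrev kb := AlgebraicClosure (ZMod p)

variable (N : ℕ)

/-- `G = GL_N(F)` with `F = ℚ_p`. -/
abbrev GG := GL (Fin N) ℚ_[p]
/-- `GL_N(O_F)` (as an abstract group, mapping onto `K ⊆ G`). -/
abbrev MM := GL (Fin N) ℤ_[p]
/-- `GL_N(k_F)`. -/
abbrev Gk := GL (Fin N) (ZMod p)

/-- The inclusion `GL_N(O_F) → GL_N(F)`. -/
def iotaM : MM p N →* GG p N := Matrix.GeneralLinearGroup.map (PadicInt.Coe.ringHom)

/-- The reduction map `red : GL_N(O_F) → GL_N(k_F)`. -/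
def redM : MM p N →* Gk p N := Matrix.GeneralLinearGroup.map (PadicInt.toZMod)

/-- Elements of `GL_N(O_F)` whose reduction is upper triangular: the Iwahori condition. -/
def Ipre : Set (MM p N) :=
  {m | ∀ i j : Fin N, j < i → ((redM p N m : Matrix (Fin N) (Fin N) (ZMod p)) i j = 0)}

/-- Elements of `GL_N(O_F)` whose reduction is upper triangular unipotent: pro-p Iwahori. -/
def I1pre : Set (MM p N) :=
  {m | m ∈ Ipre p N ∧ ∀ i : Fin N, ((redM p N m : Matrix (Fin N) (Fin N) (ZMod p)) i i = 1)}

/-- Elements of `GL_N(O_F)` reducing to the identity: `K_1 = ker red`. -/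
def K1pre : Set (MM p N) := {m | redM p N m = 1}

/-- `K = GL_N(O_F)` as a subset of `G`. -/
def Kset : Set (GG p N) := Set.range (iotaM p N)
/-- The Iwahori subgroup `I ⊆ G`. -/
def Iset : Set (GG p N) := iotaM p N '' Ipre p N
/-- The pro-p Iwahori subgroup `I_1 ⊆ G`. -/
def I1set : Set (GG p N) := iotaM p N '' I1pre p N
/-- `K_1 ⊆ G`. -/
def K1set : Set (GG p N) := iotaM p N '' K1pre p N

/-- The uniformizer `ϖ = p` as a unit of `ℚ_p`. -/
def pU : ℚ_[p]ˣ :=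
  Units.mk0 (p : ℚ_[p]) (by
    have h := (Fact.out : p.Prime).ne_zero
    exact_mod_cast Nat.cast_ne_zero.mpr h)

/-- Scalar matrices as elements of `G`. -/
def scalarGL (u : ℚ_[p]ˣ) : GG p N :=
  Units.map (algebraMap ℚ_[p] (Matrix (Fin N) (Fin N) ℚ_[p])).toMonoidHom u

/-- The central element `ϖ^n · Id`. -/
def piSc (n : ℤ) : GG p N := scalarGL p N (pU p ^ n)

/-- Invertible diagonal matrices. -/
def diagGL (d : Fin N → ℚ_[p]ˣ) : GG p N where
  val := Matrix.diagonal fun i => (d i : ℚ_[p])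
  inv := Matrix.diagonal fun i => (((d i)⁻¹ : ℚ_[p]ˣ) : ℚ_[p])
  val_inv := by
    rw [Matrix.diagonal_mul_diagonal]
    simp
  inv_val := by
    rw [Matrix.diagonal_mul_diagonal]
    simp

/-- extend `a ∈ ℤ^{N-1}` by `0` in the last coordinate. -/
def expo (a : Fin (N - 1) → ℤ) : Fin N → ℤ :=
  fun i => if h : (i : ℕ) < N - 1 then a ⟨i, h⟩ else 0

/-- `t_a = diag(ϖ^{a_1}, …, ϖ^{a_{N-1}}, 1)`. -/
def tGL (a : Fin (N - 1) → ℤ) : GG p N :=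
  diagGL p N fun i => pU p ^ (expo N a i)

/-- The permutation matrix of `σ` (with `permGL σ · e_j = e_{σ j}`, so that
`permGL` is a group homomorphism). -/
def permGL (σ : Equiv.Perm (Fin N)) : GG p N where
  val := (σ⁻¹).permMatrix ℚ_[p]
  inv := σ.permMatrix ℚ_[p]
  val_inv := by
    show ((σ⁻¹).toPEquiv.toMatrix : Matrix (Fin N) (Fin N) ℚ_[p]) * σ.toPEquiv.toMatrix = 1
    rw [← PEquiv.toMatrix_trans, ← Equiv.toPEquiv_trans]
    simp only [Equiv.self_trans_symm, Equiv.symm_trans_self, Equiv.Perm.inv_def]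
    rw [Equiv.toPEquiv_refl, PEquiv.toMatrix_refl]
  inv_val := by
    show (σ.toPEquiv.toMatrix : Matrix (Fin N) (Fin N) ℚ_[p]) * (σ⁻¹).toPEquiv.toMatrix = 1
    rw [← PEquiv.toMatrix_trans, ← Equiv.toPEquiv_trans]
    simp only [Equiv.self_trans_symm, Equiv.symm_trans_self, Equiv.Perm.inv_def]
    rw [Equiv.toPEquiv_refl, PEquiv.toMatrix_refl]

/-- `ω t_a`. -/
def wS (σ : Equiv.Perm (Fin N)) (a : Fin (N - 1) → ℤ) : GG p N :=
  permGL p N σ * tGL p N a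

/-- The permutation `ω₂` (as a matrix: first row block `(0, I_{N-1})`, last row `(1,0,…,0)`). -/
def w2 : Equiv.Perm (Fin N) := (finRotate N)⁻¹

/-- `γ = ω₂ · diag(ϖ, I_{N-1})`. -/
def gammaGL : GG p N :=
  permGL p N (w2 N) * tGL p N fun i => if (i : ℕ) = 0 then 1 else 0

/-- `S_ω = {a ∈ ℤ^{N-1} : (ω t_a) I (ω t_a)⁻¹ ∩ K ⊆ I}`. -/
def Sset (σ : Equiv.Perm (Fin N)) : Set (Fin (N - 1) → ℤ) :=
  {a | ∀ g ∈ Iset p N,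
    wS p N σ a * g * (wS p N σ a)⁻¹ ∈ Kset p N →
    wS p N σ a * g * (wS p N σ a)⁻¹ ∈ Iset p N}

/-- The unit of `k_F^×` attached to a nonzero element of `k_F` (junk value `1` at `0`). -/
def unitOf (x : ZMod p) : (ZMod p)ˣ :=
  if h : x = 0 then 1 else Units.mk0 x h

/-- The diagonal of the reduction of `m`, as an `N`-tuple of units of `k_F`. -/
def diagOf (m : MM p N) : Fin N → (ZMod p)ˣ :=
  fun i => unitOf p ((redM p N m : Matrix (Fin N) (Fin N) (ZMod p)) i i)

/-- The transformation rule for functions in `H_{IZ}(χ)`, where the character `χ` of `I`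
is given by the character `ξ` of the torus `(k_F^×)^N` through the diagonal of the
reduction, extended to `IZ` by `χ(ϖ) = 1`. -/
def HTransf (ξ : (Fin N → (ZMod p)ˣ) →* (kb p)ˣ) (φ : GG p N → kb p) : Prop :=
  ∀ (n₁ n₂ : ℤ) (m₁ m₂ : MM p N), m₁ ∈ Ipre p N → m₂ ∈ Ipre p N → ∀ g : GG p N,
    φ (piSc p N n₁ * iotaM p N m₁ * g * (piSc p N n₂ * iotaM p N m₂)) =
      (ξ (diagOf p N m₁) : kb p) * (ξ (diagOf p N m₂) : kb p) * φ g

/-- `φ` is supported on the double coset `IZ x I`. -/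
def SuppDouble (φ : GG p N → kb p) (x : GG p N) : Prop :=
  ∀ g : GG p N, φ g ≠ 0 → ∃ (n : ℤ) (m₁ m₂ : MM p N), m₁ ∈ Ipre p N ∧ m₂ ∈ Ipre p N ∧
    g = piSc p N n * iotaM p N m₁ * x * iotaM p N m₂

/-- Membership in `H_{IZ}(χ)`: the transformation rule together with support in
finitely many double cosets `IZ g I`. -/
def HMem (ξ : (Fin N → (ZMod p)ˣ) →* (kb p)ˣ) (φ : GG p N → kb p) : Prop :=
  HTransf p N ξ φ ∧
  ∃ S : Finset (GG p N), ∀ g : GG p N, φ g ≠ 0 →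
    ∃ s ∈ S, ∃ (n : ℤ) (m₁ m₂ : MM p N), m₁ ∈ Ipre p N ∧ m₂ ∈ Ipre p N ∧
      g = piSc p N n * iotaM p N m₁ * s * iotaM p N m₂

section Rep

variable {V : Type} [AddCommGroup V] [Module (kb p) V]

/-- `σ` (here `ρ`) is irreducible. -/
def IsIrred (ρ : Representation (kb p) (Gk p N) V) : Prop :=
  (∃ v : V, v ≠ 0) ∧
  ∀ W : Submodule (kb p) V, (∀ g v, v ∈ W → ρ g v ∈ W) → W = ⊥ ∨ W = ⊤

/-- Membership in the compact induction `ind_{KZ}^G σ`: left `KZ`-equivariance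
(where `ϖ` acts trivially), support in finitely many cosets `KZ g`, and smoothness. -/
def IndMem (ρ : Representation (kb p) (Gk p N) V) (f : GG p N → V) : Prop :=
  (∀ (n : ℤ) (m : MM p N) (g : GG p N),
      f (piSc p N n * iotaM p N m * g) = ρ (redM p N m) (f g)) ∧
  (∃ S : Finset (GG p N), ∀ g : GG p N, f g ≠ 0 →
      ∃ s ∈ S, ∃ (n : ℤ) (m : MM p N), g = piSc p N n * iotaM p N m * s) ∧
  (∃ U : Subgroup (GG p N), IsOpen (U : Set (GG p N)) ∧ ∀ u ∈ U, ∀ g, f (g * u) = f g)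

/-- `f` is invariant under right translation by `I_1`. -/
def IsI1Inv (f : GG p N → V) : Prop :=
  ∀ u ∈ I1set p N, ∀ g, f (g * u) = f g

/-- The defining property of the standard function `f_{ω,a}`: an `I_1`-invariant member of
`ind_{KZ}^G σ` supported on `KZ t_a I_1` with value `v₀` at `ω t_a`. -/
def IsStd (ρ : Representation (kb p) (Gk p N) V) (v₀ : V)
    (σp : Equiv.Perm (Fin N)) (a : Fin (N - 1) → ℤ) (f : GG p N → V) : Prop :=
  IndMem p N ρ f ∧ IsI1Inv p N f ∧
  (∀ g : GG p N, f g ≠ 0 → ∃ (n : ℤ) (m : MM p N) (u : GG p N), u ∈ I1set p N ∧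
      g = piSc p N n * iotaM p N m * tGL p N a * u) ∧
  f (wS p N σp a) = v₀

/-- `R` is a set of representatives for `I_1/(I_1 ∩ g⁻¹ I_1 g)`. -/
def IsRepSet (g : GG p N) (R : Finset (GG p N)) : Prop :=
  (↑R ⊆ I1set p N) ∧
  ∀ x ∈ I1set p N, ∃! r : GG p N, r ∈ R ∧
    (r⁻¹ * x ∈ I1set p N ∧ g * (r⁻¹ * x) * g⁻¹ ∈ I1set p N)

/-- The Hecke operator: `f|T_g = ∑_{r} (r g⁻¹)·f`, where `(h·f)(x) = f(xh)`. -/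
def hk (g : GG p N) (R : Finset (GG p N)) (f : GG p N → V) : GG p N → V :=
  fun x => ∑ r ∈ R, f (x * r * g⁻¹)

end Rep

/-- The lower triangular unipotent matrix with subdiagonal entries `x`, `z` and corner `y`. -/
def loU {R : Type*} [CommRing R] (x y z : R) : GL (Fin 3) R where
  val := !![1, 0, 0; x, 1, 0; y, z, 1]
  inv := !![1, 0, 0; -x, 1, 0; x * z - y, -z, 1]
  val_inv := by
    ext i j; fin_cases i <;> fin_cases j <;> simp [Matrix.mul_apply, Fin.sum_univ_three]; ring
  inv_val := by
    ext i j; fin_cases i <;> fin_cases j <;> simp [Matrix.mul_apply, Fin.sum_univ_three]; ring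

/-- The upper triangular unipotent matrix with superdiagonal entries `x`, `z` and corner `y`. -/
def upU {R : Type*} [CommRing R] (x y z : R) : GL (Fin 3) R where
  val := !![1, x, y; 0, 1, z; 0, 0, 1]
  inv := !![1, -x, x * z - y; 0, 1, -z; 0, 0, 1]
  val_inv := by
    ext i j; fin_cases i <;> fin_cases j <;> simp [Matrix.mul_apply, Fin.sum_univ_three]; ring
  inv_val := by
    ext i j; fin_cases i <;> fin_cases j <;> simp [Matrix.mul_apply, Fin.sum_univ_three]; ring

/-- Invertible diagonal `3 × 3` matrices over a commutative ring. -/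
def diU {R : Type*} [CommRing R] (d : Fin 3 → Rˣ) : GL (Fin 3) R where
  val := !![(d 0 : R), 0, 0; 0, (d 1 : R), 0; 0, 0, (d 2 : R)]
  inv := !![((d 0)⁻¹ : Rˣ).1, 0, 0; 0, ((d 1)⁻¹ : Rˣ).1, 0; 0, 0, ((d 2)⁻¹ : Rˣ).1]
  val_inv := by
    ext i j; fin_cases i <;> fin_cases j <;> simp [Matrix.mul_apply, Fin.sum_univ_three]
  inv_val := by
    ext i j; fin_cases i <;> fin_cases j <;> simp [Matrix.mul_apply, Fin.sum_univ_three]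

/-- The simple reflection exchanging the first two coordinates. -/
def refl01 {R : Type*} [CommRing R] : GL (Fin 3) R where
  val := !![0, 1, 0; 1, 0, 0; 0, 0, 1]
  inv := !![0, 1, 0; 1, 0, 0; 0, 0, 1]
  val_inv := by
    ext i j; fin_cases i <;> fin_cases j <;> simp [Matrix.mul_apply, Fin.sum_univ_three]
  inv_val := by
    ext i j; fin_cases i <;> fin_cases j <;> simp [Matrix.mul_apply, Fin.sum_univ_three]

/-- The simple reflection exchanging the last two coordinates. -/
def refl12 {R : Type*} [CommRing R] : GL (Fin 3) R where
  val := !![1, 0, 0; 0, 0, 1; 0, 1, 0]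
  inv := !![1, 0, 0; 0, 0, 1; 0, 1, 0]
  val_inv := by
    ext i j; fin_cases i <;> fin_cases j <;> simp [Matrix.mul_apply, Fin.sum_univ_three]
  inv_val := by
    ext i j; fin_cases i <;> fin_cases j <;> simp [Matrix.mul_apply, Fin.sum_univ_three]

section MatrixIdentities

variable {R : Type*} [CommRing R]

lemma loU_mul (x y z a b c : R) :
    loU x y z * loU a b c = loU (x + a) (y + z * a + b) (z + c) := by
  ext i j
  fin_cases i <;> fin_cases j <;> simp [loU, Matrix.mul_apply, Fin.sum_univ_three]

lemma loU_zero : loU (0 : R) 0 0 = 1 := by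
  ext i j; fin_cases i <;> fin_cases j <;> simp [loU]

lemma loU_inv (x y z : R) : (loU x y z)⁻¹ = loU (-x) (x * z - y) (-z) := by
  rw [inv_eq_iff_mul_eq_one, loU_mul, ← loU_zero]
  congr 1 <;> ring

lemma upU_mul (x y z a b c : R) :
    upU x y z * upU a b c = upU (a + x) (b + x * c + y) (c + z) := by
  ext i j
  fin_cases i <;> fin_cases j <;> simp [upU, Matrix.mul_apply, Fin.sum_univ_three]

lemma upU_zero : upU (0 : R) 0 0 = 1 := by
  ext i j; fin_cases i <;> fin_cases j <;> simp [upU]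

lemma loU_mul_diU (x y z : R) (d : Fin 3 → Rˣ) :
    ∃ x' y' z' : R, diU d * loU x y z = loU x' y' z' * diU d := by
  refine ⟨d 1 * x * ((d 0)⁻¹ : Rˣ), d 2 * y * ((d 0)⁻¹ : Rˣ), d 2 * z * ((d 1)⁻¹ : Rˣ), ?_⟩
  ext i j
  fin_cases i <;> fin_cases j <;> simp [loU, diU, Matrix.mul_apply, Fin.sum_univ_three]

lemma upU_mul_diU (x y z : R) (d : Fin 3 → Rˣ) :
    ∃ x' y' z' : R, upU x y z * diU d = diU d * upU x' y' z' := by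
  refine ⟨((d 0)⁻¹ : Rˣ) * x * d 1, ((d 0)⁻¹ : Rˣ) * y * d 2, ((d 1)⁻¹ : Rˣ) * z * d 2, ?_⟩
  ext i j
  fin_cases i <;> fin_cases j <;>
    simp [upU, diU, Matrix.mul_apply, Fin.sum_univ_three, ← mul_assoc]

end MatrixIdentities

variable {p} in
/-- A finite `p`-group acting on a nonzero vector space in characteristic `p` has nonzero
fixed vectors. -/
lemma exists_fixed_of_isPGroup {P : Type*} [Group P] [Finite P] (hP : IsPGroup p P)
    {W : Type*} [AddCommGroup W] [Module (kb p) W] (τ : Representation (kb p) P W)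
    {w : W} (hw : w ≠ 0) : ∃ u : W, u ≠ 0 ∧ ∀ g, τ g u = u := by
  let _ : Module (ZMod p) W := Module.compHom W (algebraMap (ZMod p) (kb p))
  have hsm : ∀ (c : ZMod p) (v : W), c • v = algebraMap (ZMod p) (kb p) c • v := fun _ _ => rfl
  let A : Submodule (ZMod p) W := Submodule.span (ZMod p) (Set.range fun g => τ g w)
  have hfin : Module.Finite (ZMod p) A := FiniteDimensional.span_of_finite _ (Set.finite_range _)
  have hA : ∀ g, ∀ v ∈ A, τ g v ∈ A := by
    intro g v hv
    induction hv using Submodule.span_induction with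
    | mem x hx =>
      obtain ⟨h, rfl⟩ := hx
      exact Submodule.subset_span ⟨g * h, by simp⟩
    | zero => simp
    | add x y _ _ hx hy => rw [map_add]; exact A.add_mem hx hy
    | smul c x _ hx => rw [hsm, map_smul, ← hsm]; exact A.smul_mem _ hx
  let _ : MulAction P A :=
    { smul := fun g v => ⟨τ g v, hA g v v.2⟩
      one_smul := fun v => Subtype.ext (by change τ 1 v = v; simp)
      mul_smul := fun g h v => Subtype.ext (by change τ (g * h) v = τ g (τ h v); simp) }
  have : Finite A := Module.finite_of_finite (ZMod p)
  have hwA : w ∈ A := Submodule.subset_span ⟨1, by simp⟩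
  have : Nontrivial A := ⟨⟨0, ⟨w, hwA⟩, fun h => hw (congrArg Subtype.val h).symm⟩⟩
  have hcard : p ∣ Nat.card A := by
    rw [Module.natCard_eq_pow_finrank (K := ZMod p), Nat.card_zmod]
    exact dvd_pow_self _ (Module.finrank_pos (R := ZMod p) (M := A)).ne'
  obtain ⟨b, hb, hb0⟩ := hP.exists_fixed_point_of_prime_dvd_card_of_fixed_point A hcard
    (a := 0) (fun g => Subtype.ext (by change τ g 0 = 0; simp))
  exact ⟨b, fun h => hb0 (Subtype.ext h.symm), fun g => congrArg Subtype.val (hb g)⟩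

/-- The subgroup of lower triangular unipotent matrices. -/
def loGroup : Subgroup (Gk p 3) where
  carrier := {g | ∃ x y z, g = loU x y z}
  mul_mem' := by
    rintro _ _ ⟨x, y, z, rfl⟩ ⟨a, b, c, rfl⟩
    exact ⟨_, _, _, loU_mul ..⟩
  one_mem' := ⟨0, 0, 0, loU_zero.symm⟩
  inv_mem' := by
    rintro _ ⟨x, y, z, rfl⟩
    exact ⟨_, _, _, loU_inv ..⟩

lemma isPGroup_loGroup : IsPGroup p (loGroup p) := by
  have e : (ZMod p × ZMod p × ZMod p) ≃ loGroup p :=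
    Equiv.ofBijective (fun t => ⟨loU t.1 t.2.1 t.2.2, t.1, t.2.1, t.2.2, rfl⟩)
      ⟨by
        rintro ⟨x, y, z⟩ ⟨a, b, c⟩ h
        have h' := congrArg (fun g : loGroup p => (g.1 : Matrix (Fin 3) (Fin 3) (ZMod p))) h
        have h1 := congrFun (congrFun h' 1) 0
        have h2 := congrFun (congrFun h' 2) 0
        have h3 := congrFun (congrFun h' 2) 1
        simp [loU] at h1 h2 h3
        simp [h1, h2, h3], by
        rintro ⟨_, x, y, z, rfl⟩
        exact ⟨(x, y, z), rfl⟩⟩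
  refine IsPGroup.of_card (n := 3) ?_
  rw [← Nat.card_congr e]
  simp
  ring

section FiniteGroup

variable {p}
variable {V : Type} [AddCommGroup V] [Module (kb p) V]

/-- The augmentation subspace of the lower triangular unipotent group. -/
def augLo (ρ : Representation (kb p) (Gk p 3) V) : Submodule (kb p) V :=
  Submodule.span (kb p) {v | ∃ x y z w, v = ρ (loU x y z) w - w}

/-- Vectors whose translates under upper triangular unipotent matrices lie in `augLo`. -/
def coreLo (ρ : Representation (kb p) (Gk p 3) V) : Submodule (kb p) V where
  carrier := {v | ∀ x y z, ρ (upU x y z) v ∈ augLo ρ}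
  add_mem' := fun ha hb x y z => by rw [map_add]; exact Submodule.add_mem _ (ha x y z) (hb x y z)
  zero_mem' := fun x y z => by simp
  smul_mem' := fun c v hv x y z => by rw [map_smul]; exact Submodule.smul_mem _ _ (hv x y z)

variable (ρ : Representation (kb p) (Gk p 3) V)

lemma augLo_sub_mem (x y z : ZMod p) (w : V) : ρ (loU x y z) w - w ∈ augLo ρ :=
  Submodule.subset_span ⟨x, y, z, w, rfl⟩

lemma augLo_lo_iff (x y z : ZMod p) (w : V) : ρ (loU x y z) w ∈ augLo ρ ↔ w ∈ augLo ρ := by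
  have h := augLo_sub_mem ρ x y z w
  constructor
  · intro hw
    simpa using Submodule.sub_mem _ hw h
  · intro hw
    simpa using Submodule.add_mem _ h hw

lemma augLo_diU {v : V} (hv : v ∈ augLo ρ) (d : Fin 3 → (ZMod p)ˣ) : ρ (diU d) v ∈ augLo ρ := by
  induction hv using Submodule.span_induction with
  | mem _ h =>
    obtain ⟨x, y, z, w, rfl⟩ := h
    obtain ⟨x', y', z', h⟩ := loU_mul_diU x y z d
    rw [map_sub, ← Module.End.mul_apply, ← map_mul, h, map_mul, Module.End.mul_apply]
    exact augLo_sub_mem ρ _ _ _ _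
  | zero => simp
  | add x y _ _ hx hy => rw [map_add]; exact Submodule.add_mem _ hx hy
  | smul c x _ hx => rw [map_smul]; exact Submodule.smul_mem _ _ hx

lemma augLo_ne_top {v : V} (hv : v ≠ 0) : augLo ρ ≠ ⊤ := by
  intro htop
  obtain ⟨f, hf, -⟩ := Submodule.exists_le_ker_of_notMem (K := kb p)
    (show v ∉ (⊥ : Submodule (kb p) V) from hv)
  have hf : f ≠ 0 := fun h => hf (by simp [h])
  obtain ⟨u, hu0, hu⟩ := exists_fixed_of_isPGroup (isPGroup_loGroup p)
    (ρ.dual.comp (loGroup p).subtype) hf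
  apply hu0
  have hle : augLo ρ ≤ LinearMap.ker u := by
    refine Submodule.span_le.mpr ?_
    rintro _ ⟨x, y, z, w, rfl⟩
    have h := LinearMap.congr_fun (hu ⟨(loU x y z)⁻¹, (loGroup p).inv_mem ⟨x, y, z, rfl⟩⟩) w
    simp [Representation.dual_apply, Module.Dual.transpose_apply] at h
    simp [h]
  rw [htop, top_le_iff, LinearMap.ker_eq_top] at hle
  exact hle

lemma coreLo_le : coreLo ρ ≤ augLo ρ := by
  intro v hv
  simpa [upU_zero] using hv 0 0 0

lemma coreLo_upU {v : V} (hv : v ∈ coreLo ρ) (x y z : ZMod p) : ρ (upU x y z) v ∈ coreLo ρ := by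
  intro a b c
  rw [← Module.End.mul_apply, ← map_mul, upU_mul]
  exact hv _ _ _

lemma coreLo_diU {v : V} (hv : v ∈ coreLo ρ) (d : Fin 3 → (ZMod p)ˣ) :
    ρ (diU d) v ∈ coreLo ρ := by
  intro a b c
  obtain ⟨x, y, z, h⟩ := upU_mul_diU a b c d
  rw [← Module.End.mul_apply, ← map_mul, h, map_mul, Module.End.mul_apply]
  exact augLo_diU ρ (hv _ _ _) d

/-- Elements of the big cell map `coreLo` into `augLo`. -/
lemma bigCell_mem {v : V} (hv : v ∈ coreLo ρ) (x y z a b c : ZMod p) (d : Fin 3 → (ZMod p)ˣ) :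
    ρ (loU x y z * diU d * upU a b c) v ∈ augLo ρ := by
  rw [mul_assoc, map_mul, Module.End.mul_apply, augLo_lo_iff, map_mul, Module.End.mul_apply]
  exact augLo_diU ρ (hv _ _ _) d

/-- Rank one argument for a simple reflection `s` with positive and negative root subgroups
`a` and `b`. -/
lemma rankOne_mem {s : Gk p 3} {a b : ZMod p → Gk p 3}
    (hab : ∀ x, x ≠ 0 → ∀ v ∈ coreLo ρ, ρ (a x * s) v ∈ augLo ρ)
    (hs : ∀ x, s * b x = a x * s)
    (hE : ∀ x y z, ∃ x' : ZMod p, ∀ t, ∃ u v w,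
      s * (b t * loU x y z) = loU u v w * (s * b (t + x')))
    {v : V} (hv : v ∈ coreLo ρ) (x : ZMod p) : ρ (a x * s) v ∈ augLo ρ := by
  by_cases hx : x = 0
  · subst hx
    have key : ∀ w ∈ augLo ρ, ∑ t, ρ (s * b t) w ∈ augLo ρ := by
      intro w hw
      induction hw using Submodule.span_induction with
      | mem _ h =>
        obtain ⟨x, y, z, w, rfl⟩ := h
        obtain ⟨x', hx'⟩ := hE x y z
        have : ∑ t, ρ (s * b t) (ρ (loU x y z) w - w) =
            ∑ t, (ρ (s * b t * loU x y z) w - ρ (s * b (t + x')) w) := by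
          simp_rw [map_sub, Finset.sum_sub_distrib]
          congr 1
          · simp
          · exact (Fintype.sum_equiv (Equiv.addRight x') _ _ fun t => rfl).symm
        rw [this]
        refine Submodule.sum_mem _ fun t _ => ?_
        obtain ⟨u, v, w', h⟩ := hx' t
        rw [mul_assoc, h, map_mul, Module.End.mul_apply]
        exact augLo_sub_mem ρ _ _ _ _
      | zero => simp
      | add x y _ _ hx hy =>
        simp_rw [map_add, Finset.sum_add_distrib]; exact Submodule.add_mem _ hx hy
      | smul c x _ hx =>
        simp_rw [map_smul, ← Finset.smul_sum]; exact Submodule.smul_mem _ _ hx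
    have h := key v (coreLo_le ρ hv)
    rw [← Finset.add_sum_erase _ _ (Finset.mem_univ 0)] at h
    rw [← hs]
    refine (Submodule.add_mem_iff_left _ (Submodule.sum_mem _ fun t ht => ?_)).mp h
    rw [hs]
    exact hab t (Finset.ne_of_mem_erase ht) v hv
  · exact hab x hx v hv

lemma coreLo_refl01 {v : V} (hv : v ∈ coreLo ρ) : ρ refl01 v ∈ coreLo ρ := by
  intro x y z
  have hfac : upU x y z * refl01 = upU x 0 0 * refl01 * upU 0 z (y - x * z) := by
    ext i j
    fin_cases i <;> fin_cases j <;> simp [upU, refl01, Matrix.mul_apply, Fin.sum_univ_three]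
  rw [← Module.End.mul_apply, ← map_mul, hfac, map_mul, Module.End.mul_apply]
  refine rankOne_mem ρ (s := refl01) (a := fun x => upU x 0 0) (b := fun x => loU x 0 0)
    ?_ ?_ ?_ (coreLo_upU ρ hv _ _ _) x
  · intro x hx v hv
    have : upU x 0 0 * refl01 = loU x⁻¹ 0 0 * diU ![Units.mk0 x hx, -(Units.mk0 x hx)⁻¹, 1] *
        upU x⁻¹ 0 0 := by
      ext i j
      fin_cases i <;> fin_cases j <;>
        simp [upU, loU, diU, refl01, Matrix.mul_apply, Fin.sum_univ_three, hx]
    rw [this]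
    exact bigCell_mem ρ hv _ _ _ _ _ _ _
  · intro x
    ext i j
    fin_cases i <;> fin_cases j <;>
      simp [upU, loU, refl01, Matrix.mul_apply, Fin.sum_univ_three]
  · intro x y z
    refine ⟨x, fun t => ⟨0, z, y - z * (t + x) + 0, ?_⟩⟩
    ext i j
    fin_cases i <;> fin_cases j <;>
      simp [loU, refl01, Matrix.mul_apply, Fin.sum_univ_three]

lemma coreLo_refl12 {v : V} (hv : v ∈ coreLo ρ) : ρ refl12 v ∈ coreLo ρ := by
  intro x y z
  have hfac : upU x y z * refl12 = upU 0 0 z * refl12 * upU y x 0 := by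
    ext i j
    fin_cases i <;> fin_cases j <;> simp [upU, refl12, Matrix.mul_apply, Fin.sum_univ_three]
  rw [← Module.End.mul_apply, ← map_mul, hfac, map_mul, Module.End.mul_apply]
  refine rankOne_mem ρ (s := refl12) (a := fun x => upU 0 0 x) (b := fun x => loU 0 0 x)
    ?_ ?_ ?_ (coreLo_upU ρ hv _ _ _) z
  · intro x hx v hv
    have : upU 0 0 x * refl12 = loU 0 0 x⁻¹ * diU ![1, Units.mk0 x hx, -(Units.mk0 x hx)⁻¹] *
        upU 0 0 x⁻¹ := by
      ext i j
      fin_cases i <;> fin_cases j <;>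
        simp [upU, loU, diU, refl12, Matrix.mul_apply, Fin.sum_univ_three, hx]
    rw [this]
    exact bigCell_mem ρ hv _ _ _ _ _ _ _
  · intro x
    ext i j
    fin_cases i <;> fin_cases j <;>
      simp [upU, loU, refl12, Matrix.mul_apply, Fin.sum_univ_three]
  · intro x y z
    refine ⟨z, fun t => ⟨y + t * x, x, 0, ?_⟩⟩
    ext i j
    fin_cases i <;> fin_cases j <;>
      simp [loU, refl12, Matrix.mul_apply, Fin.sum_univ_three]
    ring

lemma coreLo_stable (g : Gk p 3) {v : V} (hv : v ∈ coreLo ρ) : ρ g v ∈ coreLo ρ := by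
  let Q : Matrix (Fin 3) (Fin 3) (ZMod p) → Prop := fun M =>
    ∀ h : Gk p 3, h.1 = M → ∀ v ∈ coreLo ρ, ρ h v ∈ coreLo ρ
  have hup : ∀ x y z : ZMod p, ∀ v ∈ coreLo ρ, ρ (upU x y z) v ∈ coreLo ρ :=
    fun x y z v hv => coreLo_upU ρ hv x y z
  have h01 : ∀ v ∈ coreLo ρ, ρ refl01 v ∈ coreLo ρ := fun v hv => coreLo_refl01 ρ hv
  have h12 : ∀ v ∈ coreLo ρ, ρ refl12 v ∈ coreLo ρ := fun v hv => coreLo_refl12 ρ hv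
  have hlo : ∀ x y z : ZMod p, ∀ v ∈ coreLo ρ, ρ (loU x y z) v ∈ coreLo ρ := by
    intro x y z v hv
    have : loU x y z =
        refl01 * (refl12 * (refl01 * (upU z y x * (refl01 * (refl12 * refl01))))) := by
      ext i j
      fin_cases i <;> fin_cases j <;>
        simp [loU, upU, refl01, refl12, Matrix.mul_apply, Fin.sum_univ_three]
    simp only [this, map_mul, Module.End.mul_apply]
    exact h01 _ (h12 _ (h01 _ (hup _ _ _ _ (h01 _ (h12 _ (h01 _ hv))))))
  suffices Q g.1 from this g rfl v hv
  refine diagonal_transvection_induction_of_det_ne_zero Q g.1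
    (isUnit_iff_ne_zero.mp (GeneralLinearGroup.det g).isUnit) ?_ ?_ ?_
  · intro D hD h hh v hv
    rw [det_diagonal, Finset.prod_ne_zero_iff] at hD
    have : h = diU fun i => Units.mk0 (D i) (hD i (Finset.mem_univ i)) := by
      ext i j
      rw [hh]
      fin_cases i <;> fin_cases j <;> simp [diU]
    rw [this]
    exact coreLo_diU ρ hv _
  · rintro ⟨i, j, hij, c⟩ h hh v hv
    have hc : (∃ x y z, h = upU x y z) ∨ ∃ x y z, h = loU x y z := by
      rcases lt_or_gt_of_ne hij with hlt | hlt
      · refine Or.inl ⟨if i = 0 ∧ j = 1 then c else 0, if i = 0 ∧ j = 2 then c else 0,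
          if i = 1 ∧ j = 2 then c else 0, ?_⟩
        ext a b
        rw [hh]
        fin_cases i <;> fin_cases j <;> first
          | exact absurd hlt (by decide)
          | fin_cases a <;> fin_cases b <;>
              simp [upU, TransvectionStruct.toMatrix, transvection]
      · refine Or.inr ⟨if i = 1 ∧ j = 0 then c else 0, if i = 2 ∧ j = 0 then c else 0,
          if i = 2 ∧ j = 1 then c else 0, ?_⟩
        ext a b
        rw [hh]
        fin_cases i <;> fin_cases j <;> first
          | exact absurd hlt (by decide)
          | fin_cases a <;> fin_cases b <;>
              simp [loU, TransvectionStruct.toMatrix, transvection]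
    rcases hc with ⟨x, y, z, rfl⟩ | ⟨x, y, z, rfl⟩
    · exact hup _ _ _ _ hv
    · exact hlo _ _ _ _ hv
  · intro A B hA hB hPA hPB h hh v hv
    have : h = GeneralLinearGroup.mkOfDetNeZero A hA * GeneralLinearGroup.mkOfDetNeZero B hB := by
      ext i j
      rw [hh]
      rfl
    rw [this, map_mul, Module.End.mul_apply]
    exact hPA _ rfl _ (hPB _ rfl _ hv)

/-- An irreducible representation of `GL₃(𝔽_p)` carries a functional which is invariant under
lower triangular unipotent matrices and does not vanish on a given nonzero vector fixed by the
upper triangular unipotent matrices. -/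
lemma exists_functional (hirr : IsIrred p 3 ρ) {v₀ : V} (hv₀ : v₀ ≠ 0)
    (hU : ∀ x y z, ρ (upU x y z) v₀ = v₀) :
    ∃ l : V →ₗ[kb p] kb p, l v₀ ≠ 0 ∧ ∀ x y z v, l (ρ (loU x y z) v) = l v := by
  have hnot : v₀ ∉ augLo ρ := by
    intro hmem
    have hcore : v₀ ∈ coreLo ρ := fun x y z => by rwa [hU]
    rcases hirr.2 (coreLo ρ) (fun g v hv => coreLo_stable ρ g hv) with h | h
    · rw [h, Submodule.mem_bot] at hcore
      exact hv₀ hcore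
    · exact augLo_ne_top ρ hv₀ (top_le_iff.mp (h ▸ coreLo_le ρ))
  obtain ⟨l, hl, hle⟩ := Submodule.exists_le_ker_of_notMem hnot
  refine ⟨l, hl, fun x y z v => ?_⟩
  have := hle (augLo_sub_mem ρ x y z v)
  rwa [LinearMap.mem_ker, map_sub, sub_eq_zero] at this

end FiniteGroup

section Padic

variable {p}

@[simp] lemma iotaM_apply (m : MM p 3) (i j : Fin 3) :
    (iotaM p 3 m : Matrix (Fin 3) (Fin 3) ℚ_[p]) i j = ((m i j : ℤ_[p]) : ℚ_[p]) := rfl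

lemma redM_apply (m : MM p 3) (i j : Fin 3) :
    (redM p 3 m : Matrix (Fin 3) (Fin 3) (ZMod p)) i j = PadicInt.toZMod (m i j) := rfl

lemma norm_eq_one_iff_toZMod (x : ℤ_[p]) : ‖x‖ = 1 ↔ PadicInt.toZMod x ≠ 0 := by
  rw [← PadicInt.isUnit_iff, ← not_iff_not, not_not, ← mem_nonunits_iff,
    ← IsLocalRing.mem_maximalIdeal, ← PadicInt.ker_toZMod, RingHom.mem_ker]

lemma norm_det_iotaM (m : MM p 3) : ‖(iotaM p 3 m).1.det‖ = 1 := by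
  have h : (iotaM p 3 m).1.det = ((m.1.det : ℤ_[p]) : ℚ_[p]) :=
    (RingHom.map_det PadicInt.Coe.ringHom m.1).symm
  rw [h]
  exact PadicInt.isUnit_iff.mp (GeneralLinearGroup.det m).isUnit

/-- An integral matrix whose determinant has norm one lies in `GL₃(ℤ_p)`. -/
lemma exists_iotaM (A : Matrix (Fin 3) (Fin 3) ℚ_[p]) (hA : ∀ i j, ‖A i j‖ ≤ 1)
    (hdet : ‖A.det‖ = 1) : ∃ m : MM p 3, (iotaM p 3 m).1 = A := by
  let B : Matrix (Fin 3) (Fin 3) ℤ_[p] := fun i j => ⟨A i j, hA i j⟩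
  have hB : ((B.det : ℤ_[p]) : ℚ_[p]) = A.det := RingHom.map_det PadicInt.Coe.ringHom B
  have hu : IsUnit B.det := by
    rw [PadicInt.isUnit_iff, PadicInt.norm_def, hB, hdet]
  exact ⟨GeneralLinearGroup.mk'' B hu, rfl⟩

lemma exists_redM (g : Gk p 3) : ∃ m : MM p 3, redM p 3 m = g := by
  let B : Matrix (Fin 3) (Fin 3) ℤ_[p] := fun i j => ((g i j).val : ℤ_[p])
  have hB : B.map PadicInt.toZMod = g.1 := by
    ext i j
    rw [Matrix.map_apply]
    simp only [B, map_natCast]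
    exact ZMod.natCast_zmod_val _
  have hu : IsUnit B.det := by
    rw [PadicInt.isUnit_iff, norm_eq_one_iff_toZMod, RingHom.map_det]
    change (B.map PadicInt.toZMod).det ≠ 0
    rw [hB]
    exact (GeneralLinearGroup.det g).ne_zero
  exact ⟨GeneralLinearGroup.mk'' B hu, Units.ext hB⟩

lemma norm_mulVec_le {A : Matrix (Fin 3) (Fin 3) ℚ_[p]} (hA : ∀ i j, ‖A i j‖ ≤ 1)
    {v : Fin 3 → ℚ_[p]} {C : ℝ} (hC : 0 ≤ C) (hv : ∀ j, ‖v j‖ ≤ C) (i : Fin 3) :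
    ‖∑ j, A i j * v j‖ ≤ C := by
  refine IsUltrametricDist.norm_sum_le_of_forall_le_of_nonneg hC fun j _ => ?_
  rw [norm_mul]
  calc ‖A i j‖ * ‖v j‖ ≤ 1 * C := mul_le_mul (hA i j) (hv j) (norm_nonneg _) zero_le_one
    _ = C := one_mul C

lemma piSc_val (n : ℤ) : (piSc p 3 n).1 = Matrix.scalar (Fin 3) ((p : ℚ_[p]) ^ n) := by
  change (algebraMap ℚ_[p] (Matrix (Fin 3) (Fin 3) ℚ_[p])) ((pU p ^ n : ℚ_[p]ˣ) : ℚ_[p]) = _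
  rw [Units.val_zpow_eq_zpow_val]
  rfl

lemma piSc_mul_apply (n : ℤ) (g : GG p 3) (i j : Fin 3) :
    (piSc p 3 n * g).1 i j = (p : ℚ_[p]) ^ n * g.1 i j := by
  rw [Units.val_mul, piSc_val]
  simp [Matrix.scalar_apply]

lemma piSc_comm (n : ℤ) (g : GG p 3) : piSc p 3 n * g = g * piSc p 3 n := by
  ext i j
  rw [Units.val_mul, Units.val_mul, piSc_val]
  simp [Matrix.scalar_apply, mul_comm]

lemma piSc_add (m n : ℤ) : piSc p 3 (m + n) = piSc p 3 m * piSc p 3 n := by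
  rw [piSc, _root_.zpow_add, scalarGL, map_mul]; rfl

lemma piSc_zero : piSc p 3 0 = 1 := by
  simp [piSc, scalarGL]

lemma piSc_neg (n : ℤ) : (piSc p 3 n)⁻¹ = piSc p 3 (-n) := by
  rw [inv_eq_iff_mul_eq_one, ← piSc_add, add_neg_cancel, piSc_zero]

lemma p_ne_zero : (p : ℚ_[p]) ≠ 0 := Nat.cast_ne_zero.mpr (Fact.out : p.Prime).ne_zero

lemma one_lt_p : (1 : ℝ) < p := Nat.one_lt_cast.mpr (Fact.out : p.Prime).one_lt

lemma zpow_p_pos (n : ℤ) : (0 : ℝ) < (p : ℝ) ^ n := zpow_pos (zero_lt_one.trans one_lt_p) n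

/-- The element `diag(ϖ^a, ϖ^b, 1)`. -/
def tt (a b : ℤ) : GG p 3 := tGL p 3 ![a, b]

/-- The exponents of `tt a b`. -/
def ex (a b : ℤ) : Fin 3 → ℤ := ![a, b, 0]

lemma tGL_val (b : Fin 2 → ℤ) :
    (tGL p 3 b).1 = Matrix.diagonal fun i => (p : ℚ_[p]) ^ ex (b 0) (b 1) i := by
  change Matrix.diagonal (fun i => ((pU p ^ expo 3 b i : ℚ_[p]ˣ) : ℚ_[p])) = _
  congr 1
  ext i
  rw [Units.val_zpow_eq_zpow_val]
  fin_cases i <;> rfl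

lemma tt_val (a b : ℤ) :
    (tt a b : GG p 3).1 = Matrix.diagonal fun i => (p : ℚ_[p]) ^ ex a b i := tGL_val _

lemma tt_mul_apply (a b : ℤ) (g : GG p 3) (i j : Fin 3) :
    (tt a b * g).1 i j = (p : ℚ_[p]) ^ ex a b i * g.1 i j := by
  rw [Units.val_mul, tt_val, Matrix.diagonal_mul]

lemma mul_tt_apply (a b : ℤ) (g : GG p 3) (i j : Fin 3) :
    (g * tt a b).1 i j = g.1 i j * (p : ℚ_[p]) ^ ex a b j := by
  rw [Units.val_mul, tt_val, Matrix.mul_diagonal]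

lemma norm_det_piSc (n : ℤ) : ‖(piSc p 3 n).1.det‖ = (p : ℝ) ^ (-(3 * n)) := by
  rw [piSc_val, Matrix.scalar_apply, Matrix.det_diagonal]
  simp only [Finset.prod_const, Finset.card_univ, Fintype.card_fin, norm_pow,
    Padic.norm_p_zpow]
  rw [← zpow_natCast, ← _root_.zpow_mul]
  congr 1
  push_cast
  ring

lemma norm_det_tt (a b : ℤ) : ‖(tt a b : GG p 3).1.det‖ = (p : ℝ) ^ (-(a + b)) := by
  rw [tt_val, Matrix.det_diagonal, Fin.prod_univ_three]
  simp only [ex, Matrix.cons_val_zero, Matrix.cons_val_one, Matrix.cons_val, zpow_zero, mul_one,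
    norm_mul, Padic.norm_p_zpow]
  rw [← zpow_add₀ (zero_lt_one.trans one_lt_p).ne']
  congr 1
  ring

lemma diU_mul_upU_val {R : Type*} [CommRing R] (d : Fin 3 → Rˣ) (x y z : R) :
    (diU d * upU x y z).1 =
      !![(d 0 : R), d 0 * x, d 0 * y; 0, (d 1 : R), d 1 * z; 0, 0, (d 2 : R)] := by
  ext i j
  fin_cases i <;> fin_cases j <;> simp [diU, upU, Matrix.mul_apply, Fin.sum_univ_three]

/-- Membership in the Iwahori subgroup in terms of the reduction. -/
lemma mem_Ipre_iff (m : MM p 3) :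
    m ∈ Ipre p 3 ↔ ∃ x y z, redM p 3 m = diU (diagOf p 3 m) * upU x y z := by
  constructor
  · intro h
    have h10 := h 1 0 (by decide)
    have h20 := h 2 0 (by decide)
    have h21 := h 2 1 (by decide)
    have hdet := (GeneralLinearGroup.det (redM p 3 m)).ne_zero
    rw [GeneralLinearGroup.val_det_apply, Matrix.det_fin_three, h10, h20, h21] at hdet
    have hd : ∀ i, (redM p 3 m).1 i i ≠ 0 := by
      intro i hi
      fin_cases i <;> simp at hi <;> simp [hi] at hdet
    have hdi : ∀ i, (diagOf p 3 m i : ZMod p) = (redM p 3 m).1 i i := by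
      intro i
      simp [diagOf, unitOf, hd i]
    refine ⟨((diagOf p 3 m 0)⁻¹ : (ZMod p)ˣ) * (redM p 3 m).1 0 1,
      ((diagOf p 3 m 0)⁻¹ : (ZMod p)ˣ) * (redM p 3 m).1 0 2,
      ((diagOf p 3 m 1)⁻¹ : (ZMod p)ˣ) * (redM p 3 m).1 1 2, ?_⟩
    refine Units.ext ?_
    rw [diU_mul_upU_val]
    ext i j
    fin_cases i <;> fin_cases j <;> simp [hdi, hd, h10, h20, h21]
  · rintro ⟨x, y, z, h⟩ i j hij
    rw [h, diU_mul_upU_val]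
    fin_cases i <;> fin_cases j <;> first
      | exact absurd hij (by decide)
      | simp

lemma Ipre_of_redM {m : MM p 3} {d : Fin 3 → (ZMod p)ˣ} {x y z : ZMod p}
    (h : redM p 3 m = diU d * upU x y z) : m ∈ Ipre p 3 ∧ diagOf p 3 m = d := by
  have hd : diagOf p 3 m = d := by
    ext i
    simp only [diagOf, unitOf, h, diU_mul_upU_val]
    fin_cases i <;> simp
  exact ⟨(mem_Ipre_iff m).mpr ⟨x, y, z, by rw [hd, h]⟩, hd⟩

lemma diU_mul {R : Type*} [CommRing R] (d e : Fin 3 → Rˣ) : diU d * diU e = diU (d * e) := by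
  ext i j
  fin_cases i <;> fin_cases j <;> simp [diU, Matrix.mul_apply, Fin.sum_univ_three]

lemma Ipre_mul {m n : MM p 3} (hm : m ∈ Ipre p 3) (hn : n ∈ Ipre p 3) :
    m * n ∈ Ipre p 3 ∧ diagOf p 3 (m * n) = diagOf p 3 m * diagOf p 3 n := by
  obtain ⟨x, y, z, h⟩ := (mem_Ipre_iff m).mp hm
  obtain ⟨a, b, c, h'⟩ := (mem_Ipre_iff n).mp hn
  obtain ⟨u, v, w, h''⟩ := upU_mul_diU x y z (diagOf p 3 n)
  refine Ipre_of_redM (x := a + u) (y := b + u * c + v) (z := c + w) ?_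
  rw [map_mul, h, h', ← upU_mul, ← diU_mul, mul_assoc, ← mul_assoc (upU x y z), h'']
  simp only [mul_assoc]

lemma Ipre_inv {m : MM p 3} (hm : m ∈ Ipre p 3) :
    m⁻¹ ∈ Ipre p 3 ∧ diagOf p 3 m⁻¹ = (diagOf p 3 m)⁻¹ := by
  obtain ⟨x, y, z, h⟩ := (mem_Ipre_iff m).mp hm
  have hinv : (upU x y z)⁻¹ = upU (-x) (x * z - y) (-z) := by
    rw [inv_eq_iff_mul_eq_one, upU_mul, ← upU_zero]
    congr 1 <;> ring
  have hdinv : (diU (diagOf p 3 m))⁻¹ = diU (diagOf p 3 m)⁻¹ := by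
    ext i j
    rfl
  obtain ⟨u, v, w, h''⟩ := upU_mul_diU (-x) (x * z - y) (-z) (diagOf p 3 m)⁻¹
  refine Ipre_of_redM (x := u) (y := v) (z := w) ?_
  rw [map_inv, h, _root_.mul_inv_rev, hinv, hdinv, h'']

lemma norm_diag_Ipre {m : MM p 3} (hm : m ∈ Ipre p 3) (i : Fin 3) : ‖m i i‖ = 1 := by
  obtain ⟨x, y, z, h⟩ := (mem_Ipre_iff m).mp hm
  rw [norm_eq_one_iff_toZMod, ← redM_apply, h, diU_mul_upU_val]
  fin_cases i <;> simp

end Padic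

section StandardFunctions

variable {p}
variable {V : Type} [AddCommGroup V] [Module (kb p) V]
variable (ρ : Representation (kb p) (Gk p 3) V) (ξ : (Fin 3 → (ZMod p)ˣ) →* (kb p)ˣ) (v₀ : V)

open Classical in
/-- The function supported on `KZ diag(ϖ^a, ϖ^b, 1) I` which is equivariant under `K` and `I`
and takes the value `v₀` at `diag(ϖ^a, ϖ^b, 1)`. -/
def stdFun (a b : ℤ) (g : GG p 3) : V :=
  if h : ∃ t : ℤ × MM p 3 × MM p 3, t.2.2 ∈ Ipre p 3 ∧
      g = piSc p 3 t.1 * iotaM p 3 t.2.1 * tt a b * iotaM p 3 t.2.2 then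
    (ξ (diagOf p 3 h.choose.2.2) : kb p) • ρ (redM p 3 h.choose.2.1) v₀
  else 0

lemma ex_mono {a b : ℤ} (hab : a ≤ b) (hb : b ≤ 0) {i j : Fin 3} (hij : i ≤ j) :
    ex a b i ≤ ex a b j := by
  fin_cases i <;> fin_cases j <;> simp [ex] at hij ⊢ <;> omega

/-- Conjugation by `tt a b` in the dominant range preserves the Iwahori condition. -/
lemma Ipre_of_conj {a b : ℤ} (hab : a ≤ b) (hb : b ≤ 0) {m i : MM p 3} (hi : i ∈ Ipre p 3)
    (h : iotaM p 3 m * tt a b = tt a b * iotaM p 3 i) :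
    m ∈ Ipre p 3 ∧ diagOf p 3 m = diagOf p 3 i := by
  have hent : ∀ k l, ((m k l : ℤ_[p]) : ℚ_[p]) * (p : ℚ_[p]) ^ ex a b l =
      (p : ℚ_[p]) ^ ex a b k * ((i k l : ℤ_[p]) : ℚ_[p]) := by
    intro k l
    have := congrArg (fun g : GG p 3 => g.1 k l) h
    simpa only [mul_tt_apply, tt_mul_apply, iotaM_apply] using this
  have hlow : ∀ k l, l ≤ k → ∃ c : ℤ_[p], m k l = c * i k l ∧ (k = l → c = 1) := by
    intro k l hkl
    obtain ⟨n, hn⟩ := Int.eq_ofNat_of_zero_le (sub_nonneg.mpr (ex_mono hab hb hkl))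
    refine ⟨(p : ℤ_[p]) ^ n, ?_, ?_⟩
    · have h1 := hent k l
      have h2 : ex a b k = ex a b l + n := by omega
      rw [h2, zpow_add₀ p_ne_zero, mul_comm, mul_assoc] at h1
      have h3 := mul_left_cancel₀ (zpow_ne_zero _ p_ne_zero) h1
      refine PadicInt.ext ?_
      rw [h3]
      push_cast
      simp
    · rintro rfl
      have : n = 0 := by omega
      simp [this]
  constructor
  · intro k l hkl
    obtain ⟨c, hc, -⟩ := hlow k l hkl.le
    have := hi k l hkl
    rw [redM_apply] at this ⊢
    rw [hc, map_mul, this, mul_zero]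
  · ext k
    obtain ⟨c, hc, hc1⟩ := hlow k k le_rfl
    simp only [diagOf, redM_apply, hc, hc1, one_mul]

variable {ρ ξ v₀}

lemma double_coset_eq {a b n n' : ℤ} {m m' i i' : MM p 3}
    (h : piSc p 3 n * iotaM p 3 m * tt a b * iotaM p 3 i =
      piSc p 3 n' * iotaM p 3 m' * tt a b * iotaM p 3 i') :
    iotaM p 3 (m'⁻¹ * m) * tt a b = tt a b * iotaM p 3 (i' * i⁻¹) := by
  have hdet := congrArg (fun g : GG p 3 => ‖g.1.det‖) h
  simp only [Units.val_mul, Matrix.det_mul, norm_mul, norm_det_iotaM, norm_det_piSc,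
    norm_det_tt, mul_one] at hdet
  have hdet' := mul_right_cancel₀ (zpow_p_pos _).ne' hdet
  have hn : n = n' := by
    have := zpow_right_injective₀ (zero_lt_one.trans one_lt_p) one_lt_p.ne' hdet'
    omega
  subst hn
  rw [mul_assoc, mul_assoc, mul_assoc, mul_assoc] at h
  have h' := mul_left_cancel h
  rw [map_mul, map_mul, map_inv, map_inv]
  calc (iotaM p 3 m')⁻¹ * iotaM p 3 m * tt a b
      = (iotaM p 3 m')⁻¹ * (iotaM p 3 m * (tt a b * iotaM p 3 i)) * (iotaM p 3 i)⁻¹ := by group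
    _ = (iotaM p 3 m')⁻¹ * (iotaM p 3 m' * (tt a b * iotaM p 3 i')) * (iotaM p 3 i)⁻¹ := by
        rw [h']
    _ = _ := by group

lemma stdFun_apply (hχ : ∀ m ∈ Ipre p 3, ρ (redM p 3 m) v₀ = (ξ (diagOf p 3 m) : kb p) • v₀)
    {a b : ℤ} (hab : a ≤ b) (hb : b ≤ 0) (n : ℤ) (m : MM p 3) {i : MM p 3} (hi : i ∈ Ipre p 3) :
    stdFun ρ ξ v₀ a b (piSc p 3 n * iotaM p 3 m * tt a b * iotaM p 3 i) =
      (ξ (diagOf p 3 i) : kb p) • ρ (redM p 3 m) v₀ := by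
  have h : ∃ t : ℤ × MM p 3 × MM p 3, t.2.2 ∈ Ipre p 3 ∧
      piSc p 3 n * iotaM p 3 m * tt a b * iotaM p 3 i =
        piSc p 3 t.1 * iotaM p 3 t.2.1 * tt a b * iotaM p 3 t.2.2 := ⟨(n, m, i), hi, rfl⟩
  rw [stdFun, dif_pos h]
  obtain ⟨hi', heq⟩ := h.choose_spec
  generalize h.choose = t at hi' heq
  obtain ⟨n', m', i'⟩ := t
  dsimp only at hi' heq ⊢
  obtain ⟨hj, hdj⟩ := Ipre_mul hi' (Ipre_inv hi).1
  obtain ⟨hk, hdk⟩ := Ipre_of_conj hab hb hj (double_coset_eq heq)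
  have hm : m = m' * (m'⁻¹ * m) := by group
  rw [hm, map_mul, map_mul, Module.End.mul_apply, hχ _ hk, hdk, hdj, map_smul, smul_smul,
    (Ipre_inv hi).2, map_mul, map_inv, ← Units.val_mul, mul_comm (ξ (diagOf p 3 i)),
    inv_mul_cancel_right]

lemma stdFun_support {a b : ℤ} {g : GG p 3} (hg : stdFun ρ ξ v₀ a b g ≠ 0) :
    ∃ n m, ∃ i ∈ Ipre p 3, g = piSc p 3 n * iotaM p 3 m * tt a b * iotaM p 3 i := by
  unfold stdFun at hg
  split_ifs at hg with h
  · obtain ⟨⟨n, m, i⟩, hi, h⟩ := h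
    exact ⟨n, m, i, hi, h⟩
  · exact absurd rfl hg

lemma stdFun_mul_right
    (hχ : ∀ m ∈ Ipre p 3, ρ (redM p 3 m) v₀ = (ξ (diagOf p 3 m) : kb p) • v₀)
    {a b : ℤ} (hab : a ≤ b) (hb : b ≤ 0) {i : MM p 3} (hi : i ∈ Ipre p 3) (x : GG p 3) :
    stdFun ρ ξ v₀ a b (x * iotaM p 3 i) = (ξ (diagOf p 3 i) : kb p) • stdFun ρ ξ v₀ a b x := by
  by_cases hx : stdFun ρ ξ v₀ a b x = 0
  · rw [hx, smul_zero]
    by_contra h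
    obtain ⟨n, m, j, hj, hxj⟩ := stdFun_support h
    obtain ⟨h1, h2⟩ := Ipre_mul hj (Ipre_inv hi).1
    have : x = piSc p 3 n * iotaM p 3 m * tt a b * iotaM p 3 (j * i⁻¹) := by
      rw [map_mul, map_inv, ← mul_assoc, ← hxj, mul_inv_cancel_right]
    rw [this, stdFun_apply hχ hab hb n m h1] at hx
    rw [hxj, stdFun_apply hχ hab hb n m hj] at h
    rw [smul_eq_zero_iff_right (Units.ne_zero _)] at hx
    exact h (by rw [hx, smul_zero])
  · obtain ⟨n, m, j, hj, rfl⟩ := stdFun_support hx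
    obtain ⟨h1, h2⟩ := Ipre_mul hj hi
    rw [mul_assoc, ← map_mul, stdFun_apply hχ hab hb n m h1, stdFun_apply hχ hab hb n m hj, h2,
      map_mul, Units.val_mul, mul_comm, mul_smul]

lemma stdFun_mul_left
    (hχ : ∀ m ∈ Ipre p 3, ρ (redM p 3 m) v₀ = (ξ (diagOf p 3 m) : kb p) • v₀)
    {a b : ℤ} (hab : a ≤ b) (hb : b ≤ 0) (n : ℤ) (m : MM p 3) (x : GG p 3) :
    stdFun ρ ξ v₀ a b (piSc p 3 n * iotaM p 3 m * x) = ρ (redM p 3 m) (stdFun ρ ξ v₀ a b x) := by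
  have main : ∀ (n : ℤ) (m : MM p 3) (x : GG p 3), stdFun ρ ξ v₀ a b x ≠ 0 →
      stdFun ρ ξ v₀ a b (piSc p 3 n * iotaM p 3 m * x) =
        ρ (redM p 3 m) (stdFun ρ ξ v₀ a b x) := by
    intro n m x hx
    obtain ⟨n', m', j, hj, rfl⟩ := stdFun_support hx
    have : piSc p 3 n * iotaM p 3 m * (piSc p 3 n' * iotaM p 3 m' * tt a b * iotaM p 3 j) =
        piSc p 3 (n + n') * iotaM p 3 (m * m') * tt a b * iotaM p 3 j := by
      rw [piSc_add, map_mul]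
      simp only [mul_assoc]
      rw [← mul_assoc (piSc p 3 n') (iotaM p 3 m), piSc_comm n' (iotaM p 3 m)]
      simp only [mul_assoc]
    rw [this, stdFun_apply hχ hab hb _ _ hj, stdFun_apply hχ hab hb _ _ hj, map_smul, map_mul,
      map_mul, Module.End.mul_apply]
  by_cases hx : stdFun ρ ξ v₀ a b x = 0
  · rw [hx, map_zero]
    by_contra h
    have h2 := main (-n) m⁻¹ _ h
    have : piSc p 3 (-n) * iotaM p 3 m⁻¹ * (piSc p 3 n * iotaM p 3 m * x) = x := by
      rw [← piSc_neg, map_inv, piSc_comm n]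
      group
    rw [this, hx] at h2
    apply h
    have h3 := congrArg (ρ (redM p 3 m)) h2
    rw [← Module.End.mul_apply, ← map_mul, map_inv, mul_inv_cancel, map_one, map_zero] at h3
    exact h3.symm
  · exact main n m x hx

lemma norm_mul_apply_le {A : Matrix (Fin 3) (Fin 3) ℚ_[p]} (hA : ∀ i j, ‖A i j‖ ≤ 1)
    {B : Matrix (Fin 3) (Fin 3) ℚ_[p]} {k : Fin 3} {C : ℝ} (hC : 0 ≤ C)
    (hB : ∀ j, ‖B j k‖ ≤ C) (i : Fin 3) : ‖(A * B) i k‖ ≤ C := by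
  rw [Matrix.mul_apply]
  exact norm_mulVec_le hA hC hB i

lemma norm_iotaM_le (m : MM p 3) (i j : Fin 3) : ‖(iotaM p 3 m).1 i j‖ ≤ 1 := by
  rw [iotaM_apply]
  exact PadicInt.norm_le_one _

/-- Size constraints on the support of a standard function. -/
lemma stdFun_bound {a b : ℤ} (hab : a ≤ b) (hb : b ≤ 0) {g : GG p 3}
    (hg : stdFun ρ ξ v₀ a b g ≠ 0) :
    ∃ n : ℤ, ‖g.1.det‖ = (p : ℝ) ^ (-(a + b + 3 * n)) ∧
      ∀ k, (∀ j, ‖g.1 j k‖ ≤ (p : ℝ) ^ (-(a + n))) ∧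
        ∃ j, (p : ℝ) ^ (-(ex a b k + n)) ≤ ‖g.1 j k‖ := by
  obtain ⟨n, m, i, hi, rfl⟩ := stdFun_support hg
  have hp0 : (p : ℝ) ≠ 0 := (zero_lt_one.trans one_lt_p).ne'
  refine ⟨n, ?_, fun k => ⟨fun j => ?_, ?_⟩⟩
  · simp only [Units.val_mul, Matrix.det_mul, norm_mul, norm_det_iotaM, norm_det_piSc,
      norm_det_tt, mul_one]
    rw [← zpow_add₀ hp0]
    congr 1
    ring
  · rw [mul_assoc, mul_assoc, piSc_mul_apply, norm_mul, Padic.norm_p_zpow, neg_add, add_comm,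
      zpow_add₀ hp0]
    refine mul_le_mul_of_nonneg_left ?_ (zpow_p_pos _).le
    rw [Units.val_mul]
    refine norm_mul_apply_le (norm_iotaM_le m) (zpow_p_pos _).le (fun l => ?_) j
    rw [tt_mul_apply, norm_mul, Padic.norm_p_zpow]
    calc (p : ℝ) ^ (-ex a b l) * ‖(iotaM p 3 i).1 l k‖ ≤ (p : ℝ) ^ (-ex a b l) * 1 :=
          mul_le_mul_of_nonneg_left (norm_iotaM_le i l k) (zpow_p_pos _).le
      _ ≤ (p : ℝ) ^ (-a) := by
          rw [mul_one]
          exact zpow_le_zpow_right₀ one_lt_p.le (neg_le_neg (ex_mono hab hb (Fin.zero_le l)))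
  · by_contra! hlt
    set g := piSc p 3 n * iotaM p 3 m * tt a b * iotaM p 3 i with hgdef
    have hgi : tt a b * iotaM p 3 i = piSc p 3 (-n) * (iotaM p 3 m⁻¹ * g) := by
      rw [hgdef, ← piSc_neg, map_inv, piSc_comm n]
      group
    have hcol : ∀ j, ‖(iotaM p 3 m⁻¹ * g).1 j k‖ < (p : ℝ) ^ (-(ex a b k + n)) := by
      obtain ⟨j₀, -, hj₀⟩ := Finset.exists_max_image Finset.univ (fun j => ‖g.1 j k‖)
        ⟨0, Finset.mem_univ _⟩
      intro j
      rw [Units.val_mul]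
      exact (norm_mul_apply_le (norm_iotaM_le _) (norm_nonneg _)
        (fun l => hj₀ l (Finset.mem_univ l)) j).trans_lt (hlt j₀)
    have hkk := congrArg (fun g : GG p 3 => ‖g.1 k k‖) hgi
    simp only [tt_mul_apply, piSc_mul_apply, norm_mul, Padic.norm_p_zpow, iotaM_apply,
      ← PadicInt.norm_def, norm_diag_Ipre hi, mul_one] at hkk
    have := mul_lt_mul_of_pos_left (hcol k) (zpow_p_pos (p := p) (-(-n)))
    rw [← hkk, ← zpow_add₀ hp0] at this
    refine this.ne ?_
    congr 1
    ring

lemma norm_lt_one_iff_toZMod (x : ℤ_[p]) : ‖x‖ < 1 ↔ PadicInt.toZMod x = 0 := by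
  rw [lt_iff_le_and_ne, and_iff_right (PadicInt.norm_le_one x), Ne, norm_eq_one_iff_toZMod, not_not]

/-- The image of `K_1` in `G` as a subgroup. -/
def kOne : Subgroup (GG p 3) := (redM p 3).ker.map (iotaM p 3)

lemma isOpen_kOne : IsOpen (kOne (p := p) : Set (GG p 3)) := by
  have hset : (kOne (p := p) : Set (GG p 3)) =
      ⋂ i : Fin 3, ⋂ j : Fin 3,
        {g : GG p 3 | ‖g.1 i j - (1 : Matrix (Fin 3) (Fin 3) ℚ_[p]) i j‖ < 1} := by
    have hone : ∀ i j, (1 : Matrix (Fin 3) (Fin 3) ℚ_[p]) i j =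
        (((1 : Matrix (Fin 3) (Fin 3) ℤ_[p]) i j : ℤ_[p]) : ℚ_[p]) := by
      intro i j
      rw [Matrix.one_apply, Matrix.one_apply]
      split_ifs <;> simp
    have hred : ∀ i j, PadicInt.toZMod ((1 : Matrix (Fin 3) (Fin 3) ℤ_[p]) i j) =
        (1 : Matrix (Fin 3) (Fin 3) (ZMod p)) i j := by
      intro i j
      rw [Matrix.one_apply, Matrix.one_apply]
      split_ifs <;> simp
    have hclose : ∀ (x : ℤ_[p]) (i j : Fin 3),
        ‖(x : ℚ_[p]) - (1 : Matrix (Fin 3) (Fin 3) ℚ_[p]) i j‖ < 1 ↔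
        PadicInt.toZMod x = (1 : Matrix (Fin 3) (Fin 3) (ZMod p)) i j := by
      intro x i j
      rw [hone, ← PadicInt.coe_sub, ← PadicInt.norm_def, norm_lt_one_iff_toZMod, map_sub, hred,
        sub_eq_zero]
    ext g
    simp only [Set.mem_iInter, Set.mem_ofPred_eq]
    constructor
    · rintro ⟨m, hm, rfl⟩ i j
      have hm' : redM p 3 m = 1 := hm
      rw [iotaM_apply, hclose, ← redM_apply, hm', Units.val_one]
    · intro h
      have hle : ∀ i j, ‖g.1 i j‖ ≤ 1 := by
        intro i j
        rw [← sub_add_cancel (g.1 i j) ((1 : Matrix (Fin 3) (Fin 3) ℚ_[p]) i j)]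
        refine (IsUltrametricDist.norm_add_le_max _ _).trans (max_le (h i j).le ?_)
        rw [hone]
        exact PadicInt.norm_le_one _
      let B : Matrix (Fin 3) (Fin 3) ℤ_[p] := fun i j => ⟨g.1 i j, hle i j⟩
      have hB : B.map PadicInt.toZMod = 1 := by
        ext i j
        exact (hclose (B i j) i j).mp (h i j)
      have hBdet : ((B.det : ℤ_[p]) : ℚ_[p]) = g.1.det := RingHom.map_det PadicInt.Coe.ringHom B
      obtain ⟨m, hm⟩ := exists_iotaM g.1 hle (by
        rw [← hBdet, ← PadicInt.norm_def, norm_eq_one_iff_toZMod, RingHom.map_det,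
          RingHom.mapMatrix_apply, hB, Matrix.det_one]
        exact one_ne_zero)
      refine ⟨m, ?_, Units.ext hm⟩
      change redM p 3 m = 1
      ext i j
      rw [redM_apply, Units.val_one, ← hclose, ← iotaM_apply, hm]
      exact h i j
  rw [hset]
  refine isOpen_iInter_of_finite fun i => isOpen_iInter_of_finite fun j => ?_
  refine isOpen_lt ?_ continuous_const
  have : Continuous fun g : GG p 3 => g.1 i j :=
    Units.continuous_val.matrix_elem i j
  fun_prop

lemma exists_repr_finset {a b : ℤ} (hab : a ≤ b) (hb : b ≤ 0) :
    ∃ S : Finset (GG p 3), ∀ i : MM p 3, ∃ s ∈ S, ∃ m : MM p 3,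
      tt a b * iotaM p 3 i = iotaM p 3 m * s := by
  obtain ⟨r, hr⟩ := Int.eq_ofNat_of_zero_le (neg_nonneg.mpr (hab.trans hb))
  let cls : MM p 3 → Matrix (Fin 3) (Fin 3) (ZMod (p ^ r)) := fun i =>
    i.1.map (PadicInt.toZModPow r)
  have : NeZero (p ^ r) := ⟨pow_ne_zero r (Fact.out : p.Prime).ne_zero⟩
  have : Finite (Matrix (Fin 3) (Fin 3) (ZMod (p ^ r))) :=
    inferInstanceAs (Finite (Fin 3 → Fin 3 → ZMod (p ^ r)))
  obtain ⟨T, hT⟩ := (Set.toFinite (Set.range fun c : Set.range cls =>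
    tt a b * iotaM p 3 c.2.choose)).exists_finset
  refine ⟨T, fun i => ⟨_, (hT _).mpr ⟨⟨cls i, i, rfl⟩, rfl⟩, ?_⟩⟩
  dsimp only
  generalize_proofs hex
  have hrep := hex.choose_spec
  generalize hex.choose = j at hrep
  have hsub : ∀ k l, ‖(i k l : ℤ_[p]) - j k l‖ ≤ (p : ℝ) ^ (-(r : ℤ)) := by
    intro k l
    rw [PadicInt.norm_le_pow_iff_mem_span_pow, ← PadicInt.ker_toZModPow, RingHom.mem_ker, map_sub,
      sub_eq_zero]
    exact (congrFun (congrFun hrep k) l).symm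
  have hdet : ‖(tt a b * iotaM p 3 (i * j⁻¹) * (tt a b)⁻¹ : GG p 3).1.det‖ = 1 := by
    simp only [Units.val_mul, Matrix.det_mul, norm_mul, norm_det_iotaM, mul_one]
    rw [← norm_mul, ← Matrix.det_mul, ← Units.val_mul, mul_inv_cancel, Units.val_one,
      Matrix.det_one, norm_one]
  have h0 : ∀ c : ℤ, (p : ℚ_[p]) ^ c * ((p : ℚ_[p]) ^ c)⁻¹ = 1 := fun c =>
    mul_inv_cancel₀ (zpow_ne_zero c p_ne_zero)
  have hinv : ((tt a b)⁻¹ : GG p 3) = tt (-a) (-b) := by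
    rw [inv_eq_iff_mul_eq_one]
    ext k l
    rw [mul_tt_apply, tt_val]
    fin_cases k <;> fin_cases l <;>
      simp [ex, h0]
  have hone : ∀ k l, (((i * j⁻¹ : MM p 3) k l : ℤ_[p]) : ℚ_[p]) =
      (1 : Matrix (Fin 3) (Fin 3) ℚ_[p]) k l +
        ((∑ t, (i k t - j k t) * (j⁻¹ : MM p 3) t l : ℤ_[p]) : ℚ_[p]) := by
    intro k l
    have h1 : (i * j⁻¹ : MM p 3) k l = (1 : Matrix (Fin 3) (Fin 3) ℤ_[p]) k l +
        ∑ t, (i k t - j k t) * (j⁻¹ : MM p 3) t l := by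
      simp only [sub_mul, Finset.sum_sub_distrib, ← Matrix.mul_apply, ← Units.val_mul,
        mul_inv_cancel, Units.val_one]
      ring
    rw [h1, PadicInt.coe_add]
    congr 1
    rw [Matrix.one_apply, Matrix.one_apply]
    split_ifs <;> simp
  obtain ⟨m, hm⟩ := exists_iotaM _ (fun k l => by
    rw [hinv, mul_tt_apply, tt_mul_apply, iotaM_apply, hone, mul_add, add_mul]
    refine (IsUltrametricDist.norm_add_le_max _ _).trans (max_le ?_ ?_)
    · fin_cases k <;> fin_cases l <;> simp [ex, h0]
    · rw [norm_mul, norm_mul, Padic.norm_p_zpow, Padic.norm_p_zpow, ← PadicInt.norm_def]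
      have h1 : ‖∑ t, (i k t - j k t) * (j⁻¹ : MM p 3) t l‖ ≤ (p : ℝ) ^ (-(r : ℤ)) := by
        refine IsUltrametricDist.norm_sum_le_of_forall_le_of_nonneg (zpow_p_pos _).le fun t _ => ?_
        rw [norm_mul]
        exact (mul_le_of_le_one_right (norm_nonneg _) (PadicInt.norm_le_one _)).trans (hsub k t)
      calc _ ≤ (p : ℝ) ^ (-ex a b k) * (p : ℝ) ^ (-(r : ℤ)) * (p : ℝ) ^ (-ex (-a) (-b) l) := by
            gcongr
        _ = (p : ℝ) ^ (-ex a b k + -(r : ℤ) + -ex (-a) (-b) l) := by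
            rw [zpow_add₀ (zero_lt_one.trans one_lt_p).ne',
              zpow_add₀ (zero_lt_one.trans one_lt_p).ne']
        _ ≤ 1 := by
            refine zpow_le_one_of_nonpos₀ one_lt_p.le ?_
            fin_cases k <;> fin_cases l <;> simp [ex] <;> omega) hdet
  refine ⟨m, ?_⟩
  rw [Units.ext hm, map_mul, map_inv]
  group

lemma indMem_stdFun
    (hχ : ∀ m ∈ Ipre p 3, ρ (redM p 3 m) v₀ = (ξ (diagOf p 3 m) : kb p) • v₀)
    {a b : ℤ} (hab : a ≤ b) (hb : b ≤ 0) : IndMem p 3 ρ (stdFun ρ ξ v₀ a b) := by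
  refine ⟨stdFun_mul_left hχ hab hb, ?_, kOne, isOpen_kOne, ?_⟩
  · obtain ⟨S, hS⟩ := exists_repr_finset (p := p) hab hb
    refine ⟨S, fun g hg => ?_⟩
    obtain ⟨n, m, i, hi, rfl⟩ := stdFun_support hg
    obtain ⟨s, hs, m', h⟩ := hS i
    exact ⟨s, hs, n, m * m', by rw [mul_assoc, h, map_mul]; simp only [mul_assoc]⟩
  · rintro _ ⟨m, hm, rfl⟩ g
    have hm' : redM p 3 m = 1 := hm
    obtain ⟨h1, h2⟩ := Ipre_of_redM (m := m) (d := 1) (x := 0) (y := 0) (z := 0) (by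
      rw [hm', upU_zero, mul_one]
      ext i j
      fin_cases i <;> fin_cases j <;> simp [diU])
    rw [stdFun_mul_right hχ hab hb h1, h2, map_one, Units.val_one, one_smul]

end StandardFunctions

section LowerTriangular

variable {p}

lemma tt_zero : (tt 0 0 : GG p 3) = 1 := by
  ext i j
  rw [tt_val]
  fin_cases i <;> fin_cases j <;> simp [ex]

lemma tt_mul_tt (a b c d : ℤ) : (tt a b * tt c d : GG p 3) = tt (a + c) (b + d) := by
  ext i j
  rw [Units.val_mul, tt_val, tt_val, tt_val, Matrix.diagonal_mul_diagonal]
  congr 2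
  ext k
  rw [← zpow_add₀ p_ne_zero]
  fin_cases k <;> simp [ex]

lemma tt_inv (a b : ℤ) : (tt a b : GG p 3)⁻¹ = tt (-a) (-b) := by
  rw [inv_eq_iff_mul_eq_one, tt_mul_tt, add_neg_cancel, add_neg_cancel, tt_zero]

lemma loU_val {R : Type*} [CommRing R] (x y z : R) :
    (loU x y z).1 = !![1, 0, 0; x, 1, 0; y, z, 1] := rfl

lemma tt_mul_loU (a b : ℤ) (x y z : ℚ_[p]) :
    tt a b * loU x y z = loU ((p : ℚ_[p]) ^ (b - a) * x) ((p : ℚ_[p]) ^ (-a) * y)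
      ((p : ℚ_[p]) ^ (-b) * z) * tt a b := by
  have ha := zpow_ne_zero a (p_ne_zero (p := p))
  have hb := zpow_ne_zero b (p_ne_zero (p := p))
  ext i j
  rw [tt_mul_apply, mul_tt_apply, loU_val, loU_val]
  fin_cases i <;> fin_cases j <;>
    simp [ex, zpow_sub₀ (p_ne_zero (p := p))] <;> field_simp

/-- The group of lower triangular matrices with diagonal `(ϖ^k, ϖ^{-k}, 1)`. -/
def loP : Subgroup (GG p 3) where
  carrier := {g | ∃ (k : ℤ) (x y z : ℚ_[p]), g = loU x y z * tt k (-k)}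
  one_mem' := ⟨0, 0, 0, 0, by rw [loU_zero, neg_zero, tt_zero, mul_one]⟩
  mul_mem' := by
    rintro _ _ ⟨k, x, y, z, rfl⟩ ⟨l, a, b, c, rfl⟩
    have h : loU x y z * tt k (-k) * (loU a b c * tt l (-l)) =
        loU x y z * (tt k (-k) * loU a b c) * tt l (-l) := by simp only [mul_assoc]
    rw [h, tt_mul_loU, ← mul_assoc, loU_mul, mul_assoc, tt_mul_tt, ← neg_add]
    exact ⟨k + l, _, _, _, rfl⟩
  inv_mem' := by
    rintro _ ⟨k, x, y, z, rfl⟩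
    rw [_root_.mul_inv_rev, loU_inv, tt_inv, tt_mul_loU]
    exact ⟨-k, _, _, _, rfl⟩

lemma norm_det_loP {g : GG p 3} (hg : g ∈ loP) : ‖g.1.det‖ = 1 := by
  obtain ⟨k, x, y, z, rfl⟩ := hg
  rw [Units.val_mul, Matrix.det_mul, norm_mul, norm_det_tt, loU_val, Matrix.det_fin_three]
  simp

/-- Integral elements of `loP` reduce to lower unipotent matrices. -/
lemma redM_of_mem_loP {m : MM p 3} (hm : iotaM p 3 m ∈ loP) :
    ∃ x y z, redM p 3 m = loU x y z := by
  obtain ⟨k, x, y, z, h⟩ := hm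
  have hent : ∀ i j, ((m i j : ℤ_[p]) : ℚ_[p]) =
      (loU x y z).1 i j * (p : ℚ_[p]) ^ ex k (-k) j := by
    intro i j
    rw [← mul_tt_apply, ← h, iotaM_apply]
  have h0 : ‖((m 0 0 : ℤ_[p]) : ℚ_[p])‖ ≤ 1 := PadicInt.norm_le_one _
  have h1 : ‖((m 1 1 : ℤ_[p]) : ℚ_[p])‖ ≤ 1 := PadicInt.norm_le_one _
  rw [hent] at h0 h1
  simp only [loU_val, Matrix.of_apply, Matrix.cons_val, ex, one_mul, Padic.norm_p_zpow, neg_neg,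
    zpow_le_one_iff_right₀ one_lt_p] at h0 h1
  obtain rfl : k = 0 := by omega
  have hent' : ∀ i j, ((m i j : ℤ_[p]) : ℚ_[p]) = (loU x y z).1 i j := by
    intro i j
    rw [hent]
    fin_cases j <;> simp [ex]
  have h' : ∀ i j c, (loU x y z).1 i j = ((c : ℤ_[p]) : ℚ_[p]) →
      PadicInt.toZMod (m i j) = PadicInt.toZMod c := by
    intro i j c hc
    congr 1
    exact PadicInt.ext ((hent' i j).trans hc)
  refine ⟨PadicInt.toZMod (m 1 0), PadicInt.toZMod (m 2 0), PadicInt.toZMod (m 2 1), ?_⟩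
  ext i j
  rw [redM_apply, loU_val]
  fin_cases i <;> fin_cases j
  · exact (h' 0 0 1 (by simp [loU_val])).trans (map_one _)
  · exact (h' 0 1 0 (by simp [loU_val])).trans (map_zero _)
  · exact (h' 0 2 0 (by simp [loU_val])).trans (map_zero _)
  · rfl
  · exact (h' 1 1 1 (by simp [loU_val])).trans (map_one _)
  · exact (h' 1 2 0 (by simp [loU_val])).trans (map_zero _)
  · rfl
  · rfl
  · exact (h' 2 2 1 (by simp [loU_val])).trans (map_one _)

/-- The integral points of `loP`. -/
def loP₀ : Subgroup (loP (p := p)) := (iotaM p 3).range.subgroupOf loP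

end LowerTriangular

section Coinvariants

variable {p}
variable {V : Type} [AddCommGroup V] [Module (kb p) V]
variable {ρ : Representation (kb p) (Gk p 3) V} (l : V →ₗ[kb p] kb p)

/-- The sum of `l (f (y⁻¹ g))` over the cosets `y` of the integral points in `loP`. -/
def phi (f : GG p 3 → V) (g : GG p 3) : kb p :=
  ∑ᶠ q : loP (p := p) ⧸ loP₀ (p := p), l (f ((q.out : GG p 3)⁻¹ * g))

variable {l}

lemma map_eq_of_mk_eq (hl : ∀ x y z v, l (ρ (loU x y z) v) = l v) {f : GG p 3 → V}
    (hf : IndMem p 3 ρ f) {y y' : loP (p := p)} (h : (y : loP (p := p) ⧸ loP₀ (p := p)) = y')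
    (g : GG p 3) : l (f ((y : GG p 3)⁻¹ * g)) = l (f ((y' : GG p 3)⁻¹ * g)) := by
  obtain ⟨m, hm⟩ : (y⁻¹ * y' : loP (p := p)) ∈ loP₀ (p := p) := QuotientGroup.eq.mp h
  have hm' : iotaM p 3 m = (y : GG p 3)⁻¹ * y' := hm
  obtain ⟨a, b, c, hr⟩ := redM_of_mem_loP (m := m) (hm' ▸ (y⁻¹ * y').2)
  have : (y : GG p 3)⁻¹ * g = piSc p 3 0 * iotaM p 3 m * ((y' : GG p 3)⁻¹ * g) := by
    rw [piSc_zero, hm']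
    group
  rw [this, hf.1, hr, hl]

lemma finite_support_phi {f : GG p 3 → V} (hf : IndMem p 3 ρ f) (g : GG p 3) :
    (Function.support fun q : loP (p := p) ⧸ loP₀ (p := p) =>
      l (f ((q.out : GG p 3)⁻¹ * g))).Finite := by
  obtain ⟨S, hS⟩ := hf.2.1
  have hex : ∀ q : loP (p := p) ⧸ loP₀ (p := p), l (f ((q.out : GG p 3)⁻¹ * g)) ≠ 0 →
      ∃ s ∈ S, ∃ (n : ℤ) (m : MM p 3),
        (q.out : GG p 3)⁻¹ * g = piSc p 3 n * iotaM p 3 m * s :=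
    fun q hq => hS _ fun h => hq (by rw [h, map_zero])
  choose! s hs n m hsm using hex
  refine Set.Finite.of_finite_image (f := s) (S.finite_toSet.subset ?_) ?_
  · rintro _ ⟨q, hq, rfl⟩
    exact hs q hq
  · intro q hq q' hq' hqq
    have h1 := hsm q hq
    have h2 := hsm q' hq'
    rw [← hqq] at h2
    have h3 : ((q.out⁻¹ * q'.out : loP (p := p)) : GG p 3) =
        piSc p 3 (n q - n q') * iotaM p 3 (m q * (m q')⁻¹) := by
      have h4 : s q = (iotaM p 3 (m q'))⁻¹ * (piSc p 3 (n q'))⁻¹ * ((q'.out : GG p 3)⁻¹ * g) := by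
        rw [h2]; group
      rw [h4] at h1
      have h5 : (q.out : GG p 3)⁻¹ * q'.out = piSc p 3 (n q) * iotaM p 3 (m q) *
          (iotaM p 3 (m q'))⁻¹ * (piSc p 3 (n q'))⁻¹ := by
        calc (q.out : GG p 3)⁻¹ * q'.out
              = ((q.out : GG p 3)⁻¹ * g) * ((q'.out : GG p 3)⁻¹ * g)⁻¹ := by
              group
          _ = _ := by rw [h1]; group
      rw [Subgroup.coe_mul, Subgroup.coe_inv, h5, piSc_neg, mul_assoc, mul_assoc,
        ← mul_assoc (iotaM p 3 (m q)), ← piSc_comm, ← mul_assoc, ← piSc_add, map_mul, map_inv,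
        sub_eq_add_neg]
    have h6 := norm_det_loP (q.out⁻¹ * q'.out).2
    rw [h3, Units.val_mul, Matrix.det_mul, norm_mul, norm_det_piSc, norm_det_iotaM, mul_one,
      zpow_eq_one_iff_right₀ (zero_lt_one.trans one_lt_p).le one_lt_p.ne'] at h6
    have h7 : n q - n q' = 0 := by omega
    rw [h7, piSc_zero, one_mul] at h3
    rw [← QuotientGroup.out_eq' q, ← QuotientGroup.out_eq' q']
    exact QuotientGroup.eq.mpr ⟨_, h3.symm⟩

lemma phi_add {f f' : GG p 3 → V} (hf : IndMem p 3 ρ f) (hf' : IndMem p 3 ρ f') (g : GG p 3) :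
    phi l (f + f') g = phi l f g + phi l f' g := by
  simp only [phi, Pi.add_apply, map_add]
  exact finsum_add_distrib (finite_support_phi hf g) (finite_support_phi hf' g)

lemma phi_smul (c : kb p) (f : GG p 3 → V) (g : GG p 3) : phi l (c • f) g = c * phi l f g := by
  simp only [phi, Pi.smul_apply, map_smul]
  exact (smul_finsum _ _).symm

lemma phi_zero (g : GG p 3) : phi l (0 : GG p 3 → V) g = 0 := by
  simp [phi]

lemma phi_loP_mul (hl : ∀ x y z v, l (ρ (loU x y z) v) = l v) {f : GG p 3 → V}
    (hf : IndMem p 3 ρ f) {n : GG p 3} (hn : n ∈ loP) (g : GG p 3) :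
    phi l f (n * g) = phi l f g := by
  let n' : loP (p := p) := ⟨n, hn⟩
  rw [phi, phi, ← finsum_comp_equiv (MulAction.toPerm n')]
  refine finsum_congr fun q => ?_
  have h : ((n' * q.out : loP (p := p)) : loP (p := p) ⧸ loP₀ (p := p)) =
      ((MulAction.toPerm n' q).out : loP (p := p)) := by
    rw [QuotientGroup.out_eq']
    conv_rhs => rw [← QuotientGroup.out_eq' q]
    rfl
  rw [← map_eq_of_mk_eq hl hf h]
  congr 2
  simp [n', mul_assoc]

lemma phi_translate (f : GG p 3 → V) (h g : GG p 3) :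
    phi l (fun x => f (x * h)) g = phi l f (g * h) := by
  simp only [phi, mul_assoc]

lemma phi_mul_right {f : GG p 3 → V} {h : GG p 3} {c : kb p} (hc : ∀ x, f (x * h) = c • f x)
    (g : GG p 3) : phi l f (g * h) = c * phi l f g := by
  rw [← phi_translate, ← phi_smul]
  congr 1
  exact funext hc

end Coinvariants

section Hecke

variable {p}
variable {V : Type} [AddCommGroup V] [Module (kb p) V]
variable {ρ : Representation (kb p) (Gk p 3) V} {ξ : (Fin 3 → (ZMod p)ˣ) →* (kb p)ˣ}

lemma indMem_zero : IndMem p 3 ρ 0 :=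
  ⟨fun _ _ _ => (map_zero _).symm, ⟨∅, fun _ h => absurd rfl h⟩, ⊤, isOpen_univ, fun _ _ _ => rfl⟩

lemma IndMem.add {f f' : GG p 3 → V} (hf : IndMem p 3 ρ f) (hf' : IndMem p 3 ρ f') :
    IndMem p 3 ρ (f + f') := by
  classical
  obtain ⟨h1, ⟨S, hS⟩, U, hU, hUf⟩ := hf
  obtain ⟨h1', ⟨S', hS'⟩, U', hU', hUf'⟩ := hf'
  refine ⟨fun n m g => ?_, ⟨S ∪ S', fun g hg => ?_⟩, U ⊓ U', hU.inter hU', fun u hu g => ?_⟩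
  · simp only [Pi.add_apply, h1, h1', map_add]
  · by_cases h : f g = 0
    · obtain ⟨s, hs, h⟩ := hS' g fun h' => hg (by rw [Pi.add_apply, h, h', add_zero])
      exact ⟨s, Finset.mem_union_right _ hs, h⟩
    · obtain ⟨s, hs, h⟩ := hS g h
      exact ⟨s, Finset.mem_union_left _ hs, h⟩
  · simp only [Pi.add_apply, hUf u hu.1, hUf' u hu.2]

lemma IndMem.smul {f : GG p 3 → V} (hf : IndMem p 3 ρ f) (c : kb p) : IndMem p 3 ρ (c • f) := by
  obtain ⟨h1, ⟨S, hS⟩, U, hU, hUf⟩ := hf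
  refine ⟨fun n m g => ?_, ⟨S, fun g hg => hS g fun h => hg ?_⟩, U, hU, fun u hu g => ?_⟩
  · simp only [Pi.smul_apply, h1, map_smul]
  · rw [Pi.smul_apply, h, smul_zero]
  · simp only [Pi.smul_apply, hUf u hu]

lemma IndMem.sum {ι : Type*} (s : Finset ι) {F : ι → GG p 3 → V}
    (hF : ∀ i ∈ s, IndMem p 3 ρ (F i)) : IndMem p 3 ρ (∑ i ∈ s, F i) := by
  classical
  induction s using Finset.induction_on with
  | empty => exact indMem_zero
  | insert a s ha ih =>
    rw [Finset.sum_insert ha]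
    exact (hF a (Finset.mem_insert_self _ _)).add
      (ih fun i hi => hF i (Finset.mem_insert_of_mem hi))

lemma IndMem.translate {f : GG p 3 → V} (hf : IndMem p 3 ρ f) (h : GG p 3) :
    IndMem p 3 ρ fun x => f (x * h) := by
  classical
  obtain ⟨h1, ⟨S, hS⟩, U, hU, hUf⟩ := hf
  refine ⟨fun n m g => ?_, ⟨S.image (· * h⁻¹), fun g hg => ?_⟩,
    U.comap (MulAut.conj h⁻¹).toMonoidHom, hU.preimage ?_, fun u hu g => ?_⟩
  · dsimp only
    rw [mul_assoc, h1]
  · obtain ⟨s, hs, n, m, hsm⟩ := hS _ hg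
    exact ⟨_, Finset.mem_image_of_mem _ hs, n, m, by rw [← mul_assoc, ← hsm, mul_inv_cancel_right]⟩
  · change Continuous fun u : GG p 3 => h⁻¹ * u * (h⁻¹)⁻¹
    fun_prop
  · have hu' : h⁻¹ * u * (h⁻¹)⁻¹ ∈ U := hu
    dsimp only
    rw [← hUf _ hu' (g * h)]
    congr 1
    group

variable (ρ ξ) in
/-- Membership in the isotypic space of the compact induction. -/
def IsoMem (f : GG p 3 → V) : Prop :=
  IndMem p 3 ρ f ∧ ∀ m ∈ Ipre p 3, ∀ x : GG p 3,
    f (x * iotaM p 3 m) = (ξ (diagOf p 3 m) : kb p) • f x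

lemma isoMem_zero : IsoMem ρ ξ (0 : GG p 3 → V) :=
  ⟨indMem_zero, fun _ _ _ => (smul_zero _).symm⟩

lemma IsoMem.add {f f' : GG p 3 → V} (hf : IsoMem ρ ξ f) (hf' : IsoMem ρ ξ f') :
    IsoMem ρ ξ (f + f') :=
  ⟨hf.1.add hf'.1, fun m hm x => by simp only [Pi.add_apply, hf.2 m hm, hf'.2 m hm, smul_add]⟩

lemma IsoMem.smul {f : GG p 3 → V} (hf : IsoMem ρ ξ f) (c : kb p) : IsoMem ρ ξ (c • f) :=
  ⟨hf.1.smul c, fun m hm x => by simp only [Pi.smul_apply, hf.2 m hm, smul_comm c]⟩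

lemma mem_I1pre_iff {m : MM p 3} : m ∈ I1pre p 3 ↔ m ∈ Ipre p 3 ∧ diagOf p 3 m = 1 := by
  refine and_congr_right fun hm => ?_
  obtain ⟨x, y, z, h⟩ := (mem_Ipre_iff m).mp hm
  rw [h, diU_mul_upU_val]
  constructor
  · intro h'
    ext i
    have := h' i
    fin_cases i <;> simpa using this
  · intro h' i
    rw [h']
    fin_cases i <;> simp

/-- The pro-p Iwahori subgroup as a subgroup. -/
def iOne : Subgroup (GG p 3) where
  carrier := I1set p 3
  one_mem' := ⟨1, mem_I1pre_iff.mpr ⟨fun i j h => by simp [h.ne'], by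
    ext i
    simp [diagOf, unitOf]⟩, map_one _⟩
  mul_mem' := by
    rintro _ _ ⟨a, ha, rfl⟩ ⟨b, hb, rfl⟩
    rw [mem_I1pre_iff] at ha hb
    refine ⟨a * b, mem_I1pre_iff.mpr ⟨(Ipre_mul ha.1 hb.1).1, ?_⟩, map_mul _ _ _⟩
    rw [(Ipre_mul ha.1 hb.1).2, ha.2, hb.2, one_mul]
  inv_mem' := by
    rintro _ ⟨a, ha, rfl⟩
    rw [mem_I1pre_iff] at ha
    refine ⟨a⁻¹, mem_I1pre_iff.mpr ⟨(Ipre_inv ha.1).1, ?_⟩, map_inv _ _⟩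
    rw [(Ipre_inv ha.1).2, ha.2, inv_one]

lemma iotaM_mul_mul_mem {m m' : MM p 3} (hm : m ∈ Ipre p 3) (hm' : m' ∈ Ipre p 3)
    (hd : diagOf p 3 m = diagOf p 3 m') {g : GG p 3} (hg : g ∈ iOne) :
    iotaM p 3 m * g * (iotaM p 3 m')⁻¹ ∈ iOne := by
  obtain ⟨a, ha, rfl⟩ := hg
  rw [mem_I1pre_iff] at ha
  have h1 := Ipre_mul hm ha.1
  have h2 := Ipre_inv hm'
  have h3 := Ipre_mul h1.1 h2.1
  refine ⟨m * a * m'⁻¹, mem_I1pre_iff.mpr ⟨h3.1, ?_⟩, by rw [map_mul, map_mul, map_inv]⟩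
  rw [h3.2, h1.2, h2.2, ha.2, hd, mul_one, mul_inv_cancel]

lemma redM_diU (d : Fin 3 → ℤ_[p]ˣ) : redM p 3 (diU d) =
    diU (fun i => Units.map (PadicInt.toZMod (p := p)).toMonoidHom (d i)) * upU 0 0 0 := by
  rw [upU_zero, mul_one]
  ext i j
  rw [redM_apply]
  fin_cases i <;> fin_cases j <;> simp [diU]

lemma exists_diU_of_Ipre {m : MM p 3} (hm : m ∈ Ipre p 3) :
    ∃ d : Fin 3 → ℤ_[p]ˣ, diagOf p 3 m =
      fun i => Units.map (PadicInt.toZMod (p := p)).toMonoidHom (d i) := by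
  have hu : ∀ i, IsUnit (m i i) := fun i => PadicInt.isUnit_iff.mpr (norm_diag_Ipre hm i)
  refine ⟨fun i => (hu i).unit, ?_⟩
  obtain ⟨x, y, z, h⟩ := (mem_Ipre_iff m).mp hm
  ext i
  have h' : (diagOf p 3 m i : ZMod p) = (redM p 3 m : Matrix (Fin 3) (Fin 3) (ZMod p)) i i := by
    conv_rhs => rw [h, diU_mul_upU_val]
    fin_cases i <;> simp
  rw [h', redM_apply]
  rfl

lemma permGL_apply (ν : Equiv.Perm (Fin 3)) (i j : Fin 3) :
    (permGL p 3 ν).1 i j = if ν⁻¹ i = j then 1 else 0 := by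
  change ((ν⁻¹).toPEquiv.toMatrix : Matrix (Fin 3) (Fin 3) ℚ_[p]) i j = _
  rw [PEquiv.toMatrix_apply]
  simp [Equiv.toPEquiv_apply, eq_comm]

lemma diU_apply {R : Type*} [CommRing R] (d : Fin 3 → Rˣ) (i j : Fin 3) :
    (diU d).1 i j = if i = j then (d i : R) else 0 := by
  fin_cases i <;> fin_cases j <;> simp [diU]

lemma wS_mul_diU (ν : Equiv.Perm (Fin 3)) (b : Fin 2 → ℤ) (d : Fin 3 → ℤ_[p]ˣ) :
    wS p 3 ν b * iotaM p 3 (diU d) = iotaM p 3 (diU (d ∘ ⇑ν⁻¹)) * wS p 3 ν b := by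
  have hW : (wS p 3 ν b).1 = (permGL p 3 ν).1 *
      Matrix.diagonal fun i => (p : ℚ_[p]) ^ ex (b 0) (b 1) i := by
    rw [← tGL_val]
    rfl
  have hD : ∀ d : Fin 3 → ℤ_[p]ˣ, (iotaM p 3 (diU d)).1 =
      Matrix.diagonal fun i => ((d i : ℤ_[p]) : ℚ_[p]) := by
    intro d
    ext i j
    rw [iotaM_apply, diU_apply, Matrix.diagonal_apply]
    split_ifs <;> rfl
  ext i j
  rw [Units.val_mul, Units.val_mul, hD, hD, Matrix.mul_diagonal, Matrix.diagonal_mul, hW,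
    Matrix.mul_diagonal, permGL_apply, Function.comp_apply]
  split_ifs with h
  · rw [h]; ring
  · ring

lemma exists_torus_conj {ν : Equiv.Perm (Fin 3)} (hν : ∀ d, ξ (d ∘ ⇑ν⁻¹) = ξ d) (b : Fin 2 → ℤ)
    {i : MM p 3} (hi : i ∈ Ipre p 3) :
    ∃ t ∈ Ipre p 3, ∃ t' ∈ Ipre p 3, diagOf p 3 t = diagOf p 3 i ∧
      ξ (diagOf p 3 t') = ξ (diagOf p 3 i) ∧
      wS p 3 ν b * iotaM p 3 t = iotaM p 3 t' * wS p 3 ν b := by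
  obtain ⟨d, hd⟩ := exists_diU_of_Ipre hi
  obtain ⟨ht, hdt⟩ := Ipre_of_redM (redM_diU d)
  obtain ⟨ht', hdt'⟩ := Ipre_of_redM (redM_diU (d ∘ ⇑ν⁻¹))
  refine ⟨_, ht, _, ht', hdt.trans hd.symm, ?_, wS_mul_diU ν b d⟩
  rw [hdt', hd]
  exact hν fun i => Units.map (PadicInt.toZMod (p := p)).toMonoidHom (d i)

lemma IsoMem.apply_mul_iOne {f : GG p 3 → V} (hf : IsoMem ρ ξ f) {u : GG p 3} (hu : u ∈ iOne)
    (y : GG p 3) : f (y * u) = f y := by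
  obtain ⟨a, ha, rfl⟩ := hu
  rw [mem_I1pre_iff] at ha
  rw [hf.2 a ha.1, ha.2, map_one, Units.val_one, one_smul]

lemma mem_iOne_of_conj {m : MM p 3} (hm : m ∈ Ipre p 3) {y : GG p 3}
    (hy : iotaM p 3 m * y * (iotaM p 3 m)⁻¹ ∈ iOne) : y ∈ iOne := by
  have := iotaM_mul_mul_mem (Ipre_inv hm).1 (Ipre_inv hm).1 rfl hy
  rw [map_inv] at this
  convert this using 1
  group

lemma IsoMem.hk_mul {f : GG p 3 → V} (hf : IsoMem ρ ξ f) {g : GG p 3} {R : Finset (GG p 3)}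
    (hR : IsRepSet p 3 g R) {i t t' : MM p 3} (hi : i ∈ Ipre p 3) (ht : t ∈ Ipre p 3)
    (ht' : t' ∈ Ipre p 3) (hd : diagOf p 3 t = diagOf p 3 i)
    (hξ : ξ (diagOf p 3 t') = ξ (diagOf p 3 i))
    (hcomm : g * iotaM p 3 t = iotaM p 3 t' * g) (x : GG p 3) :
    hk p 3 g R f (x * iotaM p 3 i) = (ξ (diagOf p 3 i) : kb p) • hk p 3 g R f x := by
  classical
  obtain ⟨hRI, hRu⟩ := hR
  have hy : ∀ r ∈ R, iotaM p 3 i * r * (iotaM p 3 t)⁻¹ ∈ iOne := fun r hr =>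
    iotaM_mul_mul_mem hi ht hd.symm (hRI hr)
  have hex : ∀ r ∈ R, ∃ r' ∈ R, r'⁻¹ * (iotaM p 3 i * r * (iotaM p 3 t)⁻¹) ∈ iOne ∧
      g * (r'⁻¹ * (iotaM p 3 i * r * (iotaM p 3 t)⁻¹)) * g⁻¹ ∈ iOne := fun r hr =>
    (hRu _ (hy r hr)).exists
  choose! s hsR hs1 hs2 using hex
  have hsum : ∀ r ∈ R, f (x * iotaM p 3 i * r * g⁻¹) =
      (ξ (diagOf p 3 i) : kb p) • f (x * s r * g⁻¹) := by
    intro r hr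
    have h4 : g⁻¹ * iotaM p 3 t' = iotaM p 3 t * g⁻¹ := by
      rw [inv_mul_eq_iff_eq_mul, ← mul_assoc, hcomm, mul_inv_cancel_right]
    have h5 : x * iotaM p 3 i * r * g⁻¹ =
        x * s r * g⁻¹ * (g * ((s r)⁻¹ * (iotaM p 3 i * r * (iotaM p 3 t)⁻¹)) * g⁻¹) *
          iotaM p 3 t' := by
      calc x * iotaM p 3 i * r * g⁻¹
          = x * iotaM p 3 i * r * (iotaM p 3 t)⁻¹ * (iotaM p 3 t * g⁻¹) := by group
        _ = _ := by rw [← h4]; group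
    calc f (x * iotaM p 3 i * r * g⁻¹) = _ := congrArg f h5
      _ = (ξ (diagOf p 3 t') : kb p) • _ := hf.2 _ ht' _
      _ = _ := by rw [hf.apply_mul_iOne (hs2 r hr), hξ]
  have hinj : Set.InjOn s R := by
    intro r hr r' hr' hrr
    have h1 := hs1 r hr
    have h2 := hs2 r hr
    have h1' := hs1 r' hr'
    have h2' := hs2 r' hr'
    rw [← hrr] at h1' h2'
    have h3 : iotaM p 3 t * (r⁻¹ * r') * (iotaM p 3 t)⁻¹ ∈ iOne := by
      convert iOne.mul_mem (iOne.inv_mem h1) h1' using 1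
      group
    have h4 : iotaM p 3 t' * (g * (r⁻¹ * r') * g⁻¹) * (iotaM p 3 t')⁻¹ ∈ iOne := by
      have e : iotaM p 3 t' = g * iotaM p 3 t * g⁻¹ := by rw [hcomm, mul_inv_cancel_right]
      convert iOne.mul_mem (iOne.inv_mem h2) h2' using 1
      rw [e]
      group
    refine (hRu r' (hRI hr')).unique ⟨hr, mem_iOne_of_conj ht h3, mem_iOne_of_conj ht' h4⟩
      ⟨hr', ?_, ?_⟩
    · rw [inv_mul_cancel]
      exact (iOne (p := p)).one_mem
    · rw [inv_mul_cancel, mul_one, mul_inv_cancel]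
      exact (iOne (p := p)).one_mem
  have himage : R.image s = R :=
    Finset.eq_of_subset_of_card_le (Finset.image_subset_iff.mpr hsR)
      (Finset.card_image_of_injOn hinj).ge
  calc ∑ r ∈ R, f (x * iotaM p 3 i * r * g⁻¹)
      = ∑ r ∈ R, (ξ (diagOf p 3 i) : kb p) • f (x * s r * g⁻¹) := Finset.sum_congr rfl hsum
    _ = (ξ (diagOf p 3 i) : kb p) • ∑ r ∈ R.image s, f (x * r * g⁻¹) := by
        rw [Finset.sum_image hinj, Finset.smul_sum]
    _ = (ξ (diagOf p 3 i) : kb p) • hk p 3 g R f x := by rw [himage, hk]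

lemma hk_eq_sum_translate {W : Type} [AddCommGroup W] (g : GG p 3) (R : Finset (GG p 3))
    (f : GG p 3 → W) : hk p 3 g R f = ∑ r ∈ R, fun x => f (x * (r * g⁻¹)) := by
  ext x
  simp only [hk, Finset.sum_apply, mul_assoc]

lemma IsoMem.hk {f : GG p 3 → V} (hf : IsoMem ρ ξ f) {ν : Equiv.Perm (Fin 3)}
    (hν : ∀ d, ξ (d ∘ ⇑ν⁻¹) = ξ d) {b : Fin 2 → ℤ} {R : Finset (GG p 3)}
    (hR : IsRepSet p 3 (wS p 3 ν b) R) : IsoMem ρ ξ (hk p 3 (wS p 3 ν b) R f) := by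
  refine ⟨?_, fun i hi x => ?_⟩
  · rw [hk_eq_sum_translate]
    exact IndMem.sum _ fun r _ => hf.1.translate _
  · obtain ⟨t, ht, t', ht', hd, hξ, hcomm⟩ := exists_torus_conj hν b hi
    exact hf.hk_mul hR hi ht ht' hd hξ hcomm x

lemma phi_sum {ι : Type*} {l : V →ₗ[kb p] kb p} (s : Finset ι) {F : ι → GG p 3 → V}
    (hF : ∀ i ∈ s, IndMem p 3 ρ (F i)) (g : GG p 3) :
    phi l (∑ i ∈ s, F i) g = ∑ i ∈ s, phi l (F i) g := by
  classical
  induction s using Finset.induction_on with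
  | empty => exact phi_zero g
  | insert a s ha ih =>
    rw [Finset.sum_insert ha, Finset.sum_insert ha, phi_add (hF a (Finset.mem_insert_self _ _))
      (IndMem.sum s fun i hi => hF i (Finset.mem_insert_of_mem hi)),
      ih fun i hi => hF i (Finset.mem_insert_of_mem hi)]

lemma phi_hk {l : V →ₗ[kb p] kb p} {f : GG p 3 → V} (hf : IndMem p 3 ρ f) (g : GG p 3)
    (R : Finset (GG p 3)) (x : GG p 3) :
    phi l (hk p 3 g R f) x = ∑ r ∈ R, phi l f (x * (r * g⁻¹)) := by
  rw [hk_eq_sum_translate, phi_sum R fun r _ => hf.translate _]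
  simp only [phi_translate]

end Hecke

section Decomposition

variable {p}

lemma exists_Ipre_elim {c : Fin 3} {a : Fin 3 → ℚ_[p]} (hc : a c = 0) (ha : ∀ j, ‖a j‖ ≤ 1)
    (hlt : ∀ j < c, ‖a j‖ < 1) :
    ∃ i ∈ Ipre p 3, ∀ (g : GG p 3) (k j : Fin 3),
      (g * iotaM p 3 i).1 k j = g.1 k j - g.1 k c * a j := by
  let A : Matrix (Fin 3) (Fin 3) ℚ_[p] := fun k j =>
    (if k = j then 1 else 0) - if k = c then a j else 0
  have hA : ∀ k j, ‖A k j‖ ≤ 1 := by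
    intro k j
    rw [show A k j = (if k = j then 1 else 0) + -(if k = c then a j else 0) from sub_eq_add_neg _ _]
    refine (IsUltrametricDist.norm_add_le_max _ _).trans (max_le ?_ ?_)
    · split_ifs <;> simp
    · rw [norm_neg]
      split_ifs
      · exact ha j
      · simp
  have hdet : A.det = 1 := by
    rw [Matrix.det_fin_three]
    fin_cases c <;> simp_all [A]
  obtain ⟨m, hm⟩ := exists_iotaM A hA (by rw [hdet, norm_one])
  refine ⟨m, fun k j hjk => ?_, fun g k j => ?_⟩
  · rw [redM_apply, ← norm_lt_one_iff_toZMod, PadicInt.norm_def, ← iotaM_apply, hm]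
    simp only [A, hjk.ne', if_false, zero_sub, norm_neg]
    split_ifs with h
    · exact hlt j (h ▸ hjk)
    · simp
  · rw [Units.val_mul, hm, Matrix.mul_apply]
    simp only [A, mul_sub, Finset.sum_sub_distrib, mul_ite, mul_one, mul_zero,
      Finset.sum_ite_eq', Finset.mem_univ, if_true]

lemma exists_pivot {v : Fin 3 → ℚ_[p]} {T : Finset (Fin 3)} (hT : ∃ j ∈ T, v j ≠ 0) :
    ∃ c ∈ T, v c ≠ 0 ∧ ∀ j ∈ T, ‖v j‖ ≤ ‖v c‖ ∧ (j < c → ‖v j‖ < ‖v c‖) := by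
  obtain ⟨j, hj, hvj⟩ := hT
  obtain ⟨d, hd, hmax⟩ := T.exists_max_image (fun j => ‖v j‖) ⟨j, hj⟩
  have hne : (T.filter fun j => ‖v j‖ = ‖v d‖).Nonempty :=
    ⟨d, Finset.mem_filter.mpr ⟨hd, rfl⟩⟩
  obtain ⟨hcT, hcd⟩ := Finset.mem_filter.mp (Finset.min'_mem _ hne)
  refine ⟨_, hcT, fun h0 => ?_, fun k hk => ⟨?_, fun hlt => ?_⟩⟩
  · rw [h0, norm_zero] at hcd
    have := hmax j hj
    rw [← hcd] at this
    exact hvj (norm_le_zero_iff.mp this)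
  · rw [hcd]
    exact hmax k hk
  · rw [hcd]
    refine (hmax k hk).lt_of_ne fun h => ?_
    exact absurd (Finset.min'_le _ k (Finset.mem_filter.mpr ⟨hk, h⟩)) (not_le.mpr hlt)

lemma norm_div_le_one {a b : ℚ_[p]} (hb : b ≠ 0) (h : ‖a‖ ≤ ‖b‖) : ‖a / b‖ ≤ 1 := by
  rw [norm_div]
  exact (div_le_one (norm_pos_iff.mpr hb)).mpr h

lemma norm_div_lt_one {a b : ℚ_[p]} (hb : b ≠ 0) (h : ‖a‖ < ‖b‖) : ‖a / b‖ < 1 := by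
  rw [norm_div]
  exact (div_lt_one (norm_pos_iff.mpr hb)).mpr h

lemma GL_det_ne_zero (g : GG p 3) : g.1.det ≠ 0 :=
  ((Matrix.isUnit_iff_isUnit_det _).mp g.isUnit).ne_zero

/-- Iwahori column operations bring a matrix to lower triangular shape up to a permutation. -/
lemma exists_triangular (g : GG p 3) :
    ∃ i ∈ Ipre p 3, ∃ w : Equiv.Perm (Fin 3), ∀ k j : Fin 3, k < w j →
      (g * iotaM p 3 i).1 k j = 0 := by
  obtain ⟨c, -, hc, hmax⟩ := exists_pivot (v := g.1 0) (T := Finset.univ) (by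
    by_contra! h
    exact GL_det_ne_zero g (Matrix.det_eq_zero_of_row_eq_zero 0 fun j => h j (Finset.mem_univ j)))
  obtain ⟨i, hi, hgi⟩ := exists_Ipre_elim (c := c)
    (a := fun j => if j = c then 0 else g.1 0 j / g.1 0 c) (if_pos rfl)
    (fun j => by
      split_ifs
      · simp
      · exact norm_div_le_one hc (hmax j (Finset.mem_univ j)).1)
    (fun j hj => by
      rw [if_neg hj.ne]
      exact norm_div_lt_one hc ((hmax j (Finset.mem_univ j)).2 hj))
  have hg0 : ∀ j, j ≠ c → (g * iotaM p 3 i).1 0 j = 0 := by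
    intro j hj
    rw [hgi, if_neg hj, mul_div_cancel₀ _ hc, sub_self]
  generalize hA : g * iotaM p 3 i = A at hg0
  obtain ⟨c', hc'T, hc', hmax'⟩ := exists_pivot (v := A.1 1) (T := Finset.univ.erase c) (by
    by_contra! h
    refine GL_det_ne_zero A ?_
    have h1 : ∀ j, j ≠ c → A.1 1 j = 0 := fun j hj => h j (by simp [hj])
    rw [Matrix.det_fin_three]
    fin_cases c
    · simp [hg0 1, hg0 2, h1 1, h1 2]
    · simp [hg0 0, hg0 2, h1 0, h1 2]
    · simp [hg0 0, hg0 1, h1 0, h1 1])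
  have hcc' : c' ≠ c := Finset.ne_of_mem_erase hc'T
  obtain ⟨i', hi', hgi'⟩ := exists_Ipre_elim (c := c')
    (a := fun j => if j = c ∨ j = c' then 0 else A.1 1 j / A.1 1 c') (if_pos (Or.inr rfl))
    (fun j => by
      split_ifs with h
      · simp
      · push Not at h
        exact norm_div_le_one hc' (hmax' j (by simp [h.1])).1)
    (fun j hj => by
      split_ifs with h
      · simp
      · push Not at h
        exact norm_div_lt_one hc' ((hmax' j (by simp [h.1])).2 hj))
  have hw : ∀ c c' : Fin 3, c' ≠ c → ∃ w : Equiv.Perm (Fin 3), w c = 0 ∧ w c' = 1 := by decide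
  obtain ⟨w, hwc, hwc'⟩ := hw c c' hcc'
  refine ⟨i * i', (Ipre_mul hi hi').1, w, fun k j hkj => ?_⟩
  rw [map_mul, ← mul_assoc, hA, hgi']
  have hjc : j ≠ c := by
    rintro rfl
    rw [hwc] at hkj
    exact absurd hkj (Fin.not_lt_zero k)
  by_cases hjc' : j = c'
  · subst hjc'
    rw [hwc'] at hkj
    obtain rfl : k = 0 := by omega
    simp [hg0 j hjc]
  · rw [if_neg (by simp [hjc, hjc'])]
    have hk : k = 0 ∨ k = 1 := by omega
    rcases hk with rfl | rfl
    · simp [hg0 j hjc, hg0 c' hcc']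
    · rw [mul_div_cancel₀ _ hc', sub_self]

lemma exists_zpow_mul_unit {a : ℚ_[p]} (ha : a ≠ 0) :
    ∃ (e : ℤ) (u : ℤ_[p]ˣ), a = (p : ℚ_[p]) ^ e * ((u : ℤ_[p]) : ℚ_[p]) := by
  have hp := zpow_ne_zero a.valuation (p_ne_zero (p := p))
  have hn : ‖a / (p : ℚ_[p]) ^ a.valuation‖ = 1 := by
    rw [norm_div, Padic.norm_p_zpow, ← Padic.norm_eq_zpow_neg_valuation ha,
      div_self (norm_ne_zero_iff.mpr ha)]
  refine ⟨a.valuation, PadicInt.mkUnits hn, ?_⟩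
  rw [PadicInt.mkUnits_eq, mul_div_cancel₀ _ hp]

lemma permGL_mul_diU (w : Equiv.Perm (Fin 3)) (d : Fin 3 → ℤ_[p]ˣ) :
    iotaM p 3 (diU d) * permGL p 3 w = permGL p 3 w * iotaM p 3 (diU (d ∘ ⇑w)) := by
  have h := wS_mul_diU (p := p) w ![0, 0] (d ∘ ⇑w)
  have ht : wS p 3 w ![0, 0] = permGL p 3 w := by
    rw [wS, ← tt, tt_zero, mul_one]
  rw [ht] at h
  rw [h]
  congr 3
  ext i
  simp

lemma lower_triangular_eq {L : GG p 3} (hL : ∀ k j : Fin 3, k < j → L.1 k j = 0) :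
    ∃ n' ∈ loP (p := p), ∃ (x n : ℤ) (d : Fin 3 → ℤ_[p]ˣ),
      L = n' * tt x 0 * piSc p 3 n * iotaM p 3 (diU d) := by
  have hdet := GL_det_ne_zero L
  rw [Matrix.det_fin_three, hL 0 1 (by decide), hL 0 2 (by decide), hL 1 2 (by decide)] at hdet
  simp only [zero_mul, mul_zero, sub_zero, add_zero, ne_eq, mul_eq_zero, not_or] at hdet
  obtain ⟨⟨h0, h1⟩, h2⟩ := hdet
  obtain ⟨e₀, u₀, he₀⟩ := exists_zpow_mul_unit h0
  obtain ⟨e₁, u₁, he₁⟩ := exists_zpow_mul_unit h1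
  obtain ⟨e₂, u₂, he₂⟩ := exists_zpow_mul_unit h2
  refine ⟨loU (L.1 1 0 / L.1 0 0) (L.1 2 0 / L.1 0 0) (L.1 2 1 / L.1 1 1) *
    tt (e₂ - e₁) (-(e₂ - e₁)), ⟨_, _, _, _, rfl⟩, e₀ + e₁ - 2 * e₂, e₂, ![u₀, u₁, u₂], ?_⟩
  have hD : (iotaM p 3 (diU ![u₀, u₁, u₂])).1 = Matrix.diagonal
      ![((u₀ : ℤ_[p]) : ℚ_[p]), ((u₁ : ℤ_[p]) : ℚ_[p]), ((u₂ : ℤ_[p]) : ℚ_[p])] := by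
    ext i j
    rw [iotaM_apply, diU_apply, Matrix.diagonal_apply]
    fin_cases i <;> fin_cases j <;> simp
  have hp := p_ne_zero (p := p)
  have hd₀ : L.1 0 0 = (p : ℚ_[p]) ^ e₂ * (p : ℚ_[p]) ^ (e₂ - e₁) *
      (p : ℚ_[p]) ^ (e₀ + e₁ - 2 * e₂) * ((u₀ : ℤ_[p]) : ℚ_[p]) := by
    rw [he₀, ← zpow_add₀ hp, ← zpow_add₀ hp]
    congr 2
    ring
  have hd₁ : L.1 1 1 = (p : ℚ_[p]) ^ e₂ * ((p : ℚ_[p]) ^ (e₂ - e₁))⁻¹ *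
      ((u₁ : ℤ_[p]) : ℚ_[p]) := by
    rw [he₁, ← _root_.zpow_neg, ← zpow_add₀ hp]
    congr 2
    ring
  rw [← piSc_comm]
  ext i j
  rw [Units.val_mul, hD, Matrix.mul_diagonal, ← mul_assoc, mul_tt_apply, piSc_mul_apply,
    mul_tt_apply, loU_val]
  fin_cases i <;> fin_cases j <;> simp [ex, hL, -neg_sub]
  · exact hd₀
  · linear_combination (L.1 1 0 / L.1 0 0) * hd₀ - div_mul_cancel₀ (L.1 1 0) h0
  · exact hd₁
  · linear_combination (L.1 2 0 / L.1 0 0) * hd₀ - div_mul_cancel₀ (L.1 2 0) h0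
  · linear_combination (L.1 2 1 / L.1 1 1) * hd₁ - div_mul_cancel₀ (L.1 2 1) h1
  · exact he₂

/-- Every element of `G` is the product of an element of `loP`, a power of the uniformizer in the
first diagonal entry, a permutation matrix, an Iwahori element and a central element. -/
lemma exists_decomposition (g : GG p 3) :
    ∃ n' ∈ loP (p := p), ∃ (x : ℤ) (w : Equiv.Perm (Fin 3)), ∃ i ∈ Ipre p 3, ∃ n : ℤ,
      g = n' * (tt x 0 * permGL p 3 w) * iotaM p 3 i * piSc p 3 n := by
  obtain ⟨i, hi, w, hw⟩ := exists_triangular g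
  have hP : ∀ k j, ((permGL p 3 w)⁻¹).1 k j = if w k = j then 1 else 0 := by
    intro k j
    change (w.toPEquiv.toMatrix : Matrix (Fin 3) (Fin 3) ℚ_[p]) k j = _
    rw [PEquiv.toMatrix_apply]
    simp [Equiv.toPEquiv_apply, eq_comm]
  obtain ⟨n', hn', x, n, d, h⟩ := lower_triangular_eq (L := g * iotaM p 3 i * (permGL p 3 w)⁻¹)
    (by
      intro k j hkj
      rw [Units.val_mul, Matrix.mul_apply]
      refine Finset.sum_eq_zero fun t _ => ?_
      rw [hP]
      split_ifs with ht
      · rw [hw k t (ht ▸ hkj), zero_mul]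
      · rw [mul_zero])
  refine ⟨n', hn', x, w, diU (d ∘ ⇑w) * i⁻¹,
    (Ipre_mul (Ipre_of_redM (redM_diU _)).1 (Ipre_inv hi).1).1, n, ?_⟩
  have h' : g = n' * tt x 0 * piSc p 3 n * (iotaM p 3 (diU d) * permGL p 3 w) *
      (iotaM p 3 i)⁻¹ := by
    rw [← mul_assoc, ← h]
    group
  rw [h', permGL_mul_diU, map_mul, map_inv, ← piSc_comm, ← piSc_comm]
  simp only [mul_assoc]

end Decomposition

section Kernel

variable {p}
variable {V : Type} [AddCommGroup V] [Module (kb p) V]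
variable {ρ : Representation (kb p) (Gk p 3) V} {ξ : (Fin 3 → (ZMod p)ˣ) →* (kb p)ˣ} {v₀ : V}
variable {l : V →ₗ[kb p] kb p}

lemma mul_permGL_apply (g : GG p 3) (w : Equiv.Perm (Fin 3)) (i j : Fin 3) :
    (g * permGL p 3 w).1 i j = g.1 i (w j) := by
  rw [Units.val_mul, Matrix.mul_apply, Finset.sum_eq_single (w j)]
  · rw [permGL_apply, if_pos (show w⁻¹ (w j) = j from w.symm_apply_apply j), mul_one]
  · intro k _ hk
    rw [permGL_apply, if_neg, mul_zero]
    rintro rfl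
    exact hk (w.apply_symm_apply k).symm
  · exact fun h => absurd (Finset.mem_univ _) h

lemma norm_det_permGL (w : Equiv.Perm (Fin 3)) : ‖(permGL p 3 w).1.det‖ = 1 := by
  change ‖((w⁻¹).permMatrix ℚ_[p]).det‖ = 1
  rw [Matrix.det_permutation]
  rcases Int.units_eq_one_or (Equiv.Perm.sign w⁻¹) with h | h <;> simp [h]

lemma loP_apply_two {n : GG p 3} (hn : n ∈ loP) (i : Fin 3) :
    n.1 i 2 = if i = 2 then 1 else 0 := by
  obtain ⟨k, x, y, z, rfl⟩ := hn
  rw [mul_tt_apply, loU_val]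
  fin_cases i <;> simp [ex]

/-- The double cosets on which the coinvariants of a standard function may be nonzero. -/
lemma exists_of_phi_stdFun_ne_zero {a b x : ℤ} (hab : a ≤ b) (hb : b ≤ 0)
    {w : Equiv.Perm (Fin 3)} (h : phi l (stdFun ρ ξ v₀ a b) (tt x 0 * permGL p 3 w) ≠ 0) :
    ∃ n : ℤ, 0 ≤ n ∧ n ≤ -a ∧ x = a + b + 3 * n := by
  obtain ⟨q, hq⟩ : ∃ q : loP (p := p) ⧸ loP₀ (p := p),
      l (stdFun ρ ξ v₀ a b ((q.out : GG p 3)⁻¹ * (tt x 0 * permGL p 3 w))) ≠ 0 := by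
    by_contra! h'
    exact h (finsum_eq_zero_of_forall_eq_zero h')
  have hq' : stdFun ρ ξ v₀ a b ((q.out : GG p 3)⁻¹ * (tt x 0 * permGL p 3 w)) ≠ 0 :=
    fun h' => hq (by rw [h', map_zero])
  obtain ⟨n, hdet, hcol⟩ := stdFun_bound hab hb hq'
  have hn : (q.out : GG p 3)⁻¹ ∈ loP := (q.out⁻¹).2
  have hent : ∀ i, ((q.out : GG p 3)⁻¹ * (tt x 0 * permGL p 3 w)).1 i (w⁻¹ 2) =
      if i = 2 then 1 else 0 := by
    intro i
    rw [← mul_assoc, mul_permGL_apply, show w (w⁻¹ 2) = 2 from w.apply_symm_apply 2, mul_tt_apply,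
      loP_apply_two hn]
    simp [ex]
  obtain ⟨hle, j, hj⟩ := hcol (w⁻¹ 2)
  have h2 := hle 2
  rw [hent, if_pos rfl, norm_one, one_le_zpow_iff_right₀ one_lt_p] at h2
  have hj' : (p : ℝ) ^ (-(ex a b (w⁻¹ 2) + n)) ≤ 1 := by
    refine hj.trans ?_
    rw [hent]
    split_ifs <;> simp
  rw [zpow_le_one_iff_right₀ one_lt_p] at hj'
  have hex : ex a b (w⁻¹ 2) ≤ 0 := ex_mono hab hb (j := 2) (by omega)
  simp only [Units.val_mul, Matrix.det_mul, norm_mul, norm_det_permGL, norm_det_tt, mul_one] at hdet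
  rw [norm_det_loP hn, one_mul] at hdet
  have hx := zpow_right_injective₀ (zero_lt_one.trans one_lt_p) one_lt_p.ne' hdet
  exact ⟨n, by omega, by omega, by omega⟩

lemma stdFun_tt_self (hχ : ∀ m ∈ Ipre p 3, ρ (redM p 3 m) v₀ = (ξ (diagOf p 3 m) : kb p) • v₀)
    {a b : ℤ} (hab : a ≤ b) (hb : b ≤ 0) : stdFun ρ ξ v₀ a b (tt a b) = v₀ := by
  obtain ⟨h1, h2⟩ := Ipre_of_redM (p := p) (m := 1) (d := 1) (x := 0) (y := 0) (z := 0) (by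
    rw [map_one, upU_zero, mul_one]
    ext i j
    fin_cases i <;> fin_cases j <;> simp [diU])
  have h := stdFun_apply (ρ := ρ) hχ hab hb 0 1 h1
  rwa [piSc_zero, map_one, map_one, mul_one, mul_one, one_mul, h2, map_one,
    map_one, Units.val_one, one_smul, Module.End.one_apply] at h

lemma eq_of_stdFun_tt_ne_zero {a b a' b' : ℤ} (hab : a ≤ b) (hb : b ≤ 0)
    (h : stdFun ρ ξ v₀ a b (tt a' b') ≠ 0) : a' = a ∧ b' = b := by
  obtain ⟨n, hdet, hcol⟩ := stdFun_bound hab hb h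
  rw [norm_det_tt] at hdet
  have hx := zpow_right_injective₀ (zero_lt_one.trans one_lt_p) one_lt_p.ne' hdet
  have hent : ∀ i j, ‖(tt a' b' : GG p 3).1 i j‖ ≤ (p : ℝ) ^ (-ex a' b' j) := by
    intro i j
    rw [tt_val, Matrix.diagonal_apply]
    split_ifs with hij
    · rw [hij, Padic.norm_p_zpow]
    · rw [norm_zero]
      exact (zpow_p_pos _).le
  have hlow : ∀ k, ex a' b' k ≤ ex a b k + n := by
    intro k
    obtain ⟨j, hj⟩ := (hcol k).2
    have := (zpow_le_zpow_iff_right₀ one_lt_p).mp (hj.trans (hent j k))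
    omega
  have h0 := (hcol 0).1 0
  rw [tt_val, Matrix.diagonal_apply_eq, Padic.norm_p_zpow, zpow_le_zpow_iff_right₀ one_lt_p] at h0
  have l0 := hlow 0
  have l1 := hlow 1
  have l2 := hlow 2
  simp only [ex, Matrix.cons_val] at h0 l0 l1 l2
  omega

end Kernel

section StableSubspace

variable {p}
variable {V : Type} [AddCommGroup V] [Module (kb p) V]
variable {ρ : Representation (kb p) (Gk p 3) V} {ξ : (Fin 3 → (ZMod p)ˣ) →* (kb p)ˣ} {v₀ : V}
variable {l : V →ₗ[kb p] kb p}

lemma isoMem_stdFun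
    (hχ : ∀ m ∈ Ipre p 3, ρ (redM p 3 m) v₀ = (ξ (diagOf p 3 m) : kb p) • v₀)
    {a b : ℤ} (hab : a ≤ b) (hb : b ≤ 0) : IsoMem ρ ξ (stdFun ρ ξ v₀ a b) :=
  ⟨indMem_stdFun hχ hab hb, fun _ hm x => stdFun_mul_right hχ hab hb hm x⟩

lemma IsoMem.sum {ι : Type*} (s : Finset ι) {F : ι → GG p 3 → V}
    (hF : ∀ i ∈ s, IsoMem ρ ξ (F i)) : IsoMem ρ ξ (∑ i ∈ s, F i) := by
  classical
  induction s using Finset.induction_on with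
  | empty => exact isoMem_zero
  | insert a s ha ih =>
    rw [Finset.sum_insert ha]
    exact (hF a (Finset.mem_insert_self _ _)).add
      (ih fun i hi => hF i (Finset.mem_insert_of_mem hi))

variable (ρ ξ l) in
/-- The isotypic functions all of whose coinvariants vanish. -/
def phiKer : Set (GG p 3 → V) := {f | IsoMem ρ ξ f ∧ ∀ g, phi l f g = 0}

lemma phi_eq_zero_of_forall (hl : ∀ x y z v, l (ρ (loU x y z) v) = l v) {f : GG p 3 → V}
    (hf : IsoMem ρ ξ f) (h : ∀ x w, phi l f (tt x 0 * permGL p 3 w) = 0) (g : GG p 3) :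
    phi l f g = 0 := by
  obtain ⟨n', hn', x, w, i, hi, n, rfl⟩ := exists_decomposition g
  have hc : ∀ y, f (y * piSc p 3 n) = (1 : kb p) • f y := by
    intro y
    have h1 := hf.1.1 n 1 y
    rwa [map_one, map_one, mul_one, map_one, Module.End.one_apply, piSc_comm,
      ← one_smul (kb p) (f y)] at h1
  rw [phi_mul_right hc, phi_mul_right (hf.2 i hi), phi_loP_mul hl hf.1 hn', h, mul_zero, mul_zero]

lemma exists_phiKer_ne_zero
    (hχ : ∀ m ∈ Ipre p 3, ρ (redM p 3 m) v₀ = (ξ (diagOf p 3 m) : kb p) • v₀) (hv₀ : v₀ ≠ 0)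
    (hl : ∀ x y z v, l (ρ (loU x y z) v) = l v) : ∃ f ∈ phiKer ρ ξ l, f ≠ 0 := by
  let a : Fin 51 × Fin 51 → ℤ := fun t => -(50 + (t.1 : ℕ))
  let b : Fin 51 × Fin 51 → ℤ := fun t => -(t.2 : ℕ)
  have hab : ∀ t, a t ≤ b t := fun t => by
    dsimp only [a, b]
    omega
  have hb : ∀ t, b t ≤ 0 := fun t => by
    dsimp only [b]
    omega
  let e : Fin 51 × Fin 51 → GG p 3 → V := fun t => stdFun ρ ξ v₀ (a t) (b t)
  have he : ∀ t, IsoMem ρ ξ (e t) := fun t => isoMem_stdFun hχ (hab t) (hb t)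
  let L := Fintype.linearCombination (kb p)
    (fun (t : Fin 51 × Fin 51) (s : Fin 351 × Equiv.Perm (Fin 3)) =>
      phi l (e t) (tt ((s.1 : ℕ) - 150) 0 * permGL p 3 s.2))
  obtain ⟨c, hcL, hc⟩ := Submodule.exists_mem_ne_zero_of_ne_bot
    (LinearMap.ker_ne_bot_of_finrank_lt (f := L) (by
      simp [Fintype.card_perm, Nat.factorial]))
  have hsum : IsoMem ρ ξ (∑ t, c t • e t) := IsoMem.sum _ fun t _ => (he t).smul _
  have hphi : ∀ g, phi l (∑ t, c t • e t) g = ∑ t, c t * phi l (e t) g := by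
    intro g
    rw [phi_sum _ fun t _ => (he t).1.smul _]
    simp only [phi_smul]
  refine ⟨∑ t, c t • e t, ⟨hsum, phi_eq_zero_of_forall hl hsum fun x w => ?_⟩, fun h0 => ?_⟩
  · rw [hphi]
    by_cases hx : -150 ≤ x ∧ x ≤ 200
    · have h := congrFun (LinearMap.mem_ker.mp hcL) (⟨(x + 150).toNat, by omega⟩, w)
      simp only [L, Fintype.linearCombination_apply, Finset.sum_apply, Pi.smul_apply, smul_eq_mul,
        Pi.zero_apply] at h
      rwa [Int.toNat_of_nonneg (by omega), add_sub_cancel_right] at h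
    · refine Finset.sum_eq_zero fun t _ => ?_
      by_contra hne
      obtain ⟨n, h1, h2, h3⟩ :=
        exists_of_phi_stdFun_ne_zero (hab t) (hb t) (right_ne_zero_of_mul hne)
      dsimp only [a, b] at h2 h3
      omega
  · obtain ⟨t, ht⟩ := Function.ne_iff.mp hc
    have h := congrFun h0 (tt (a t) (b t))
    rw [Finset.sum_apply, Finset.sum_eq_single t] at h
    · rw [Pi.smul_apply, Pi.zero_apply, show e t (tt (a t) (b t)) = v₀ from
        stdFun_tt_self hχ (hab t) (hb t)] at h
      exact (smul_ne_zero ht hv₀) h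
    · intro s _ hst
      by_contra hne
      obtain ⟨ha', hb'⟩ := eq_of_stdFun_tt_ne_zero (hab s) (hb s) (right_ne_zero_of_smul hne)
      refine hst (Prod.ext ?_ ?_)
      · dsimp only [a] at ha'
        omega
      · dsimp only [b] at hb'
        omega
    · exact fun h' => absurd (Finset.mem_univ _) h'

lemma phi_stdFun_of_lt {i j : ℕ} (hij : i < j) :
    phi l (stdFun ρ ξ v₀ (-i) (-i)) (tt (-(2 * j)) 0) = 0 := by
  by_contra h
  have h1 : permGL p 3 1 = 1 := by
    ext i j
    rw [permGL_apply, Units.val_one, Matrix.one_apply]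
    rfl
  rw [← mul_one (tt _ 0), ← h1] at h
  obtain ⟨n, hn, -, hx⟩ := exists_of_phi_stdFun_ne_zero le_rfl (by omega) h
  omega

/-- Only one coset of the integral points contributes to the leading coinvariant. -/
lemma eq_iotaM_mul_tt {m : ℕ} {y : GG p 3} (hy : y ∈ loP)
    (h : stdFun ρ ξ v₀ (-m) (-m) (y * tt (-(2 * m)) 0) ≠ 0) :
    ∃ i, y = iotaM p 3 i * tt m (-m) := by
  obtain ⟨n, hdet, hcol⟩ := stdFun_bound le_rfl (by omega) h
  rw [Units.val_mul, Matrix.det_mul, norm_mul, norm_det_loP hy, one_mul, norm_det_tt] at hdet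
  have hn := zpow_right_injective₀ (zero_lt_one.trans one_lt_p) one_lt_p.ne' hdet
  obtain rfl : n = 0 := by omega
  obtain ⟨k, x, y, z, rfl⟩ := hy
  have hent : ∀ i j, ‖(loU x y z : GG p 3).1 i j‖ *
      (p : ℝ) ^ (-(ex k (-k) j + ex (-(2 * m)) 0 j)) ≤ (p : ℝ) ^ (m : ℤ) := by
    intro i j
    have h1 := (hcol j).1 i
    rw [mul_tt_apply, mul_tt_apply, norm_mul, norm_mul, Padic.norm_p_zpow, Padic.norm_p_zpow,
      mul_assoc, ← zpow_add₀ (zero_lt_one.trans one_lt_p).ne'] at h1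
    convert h1 using 3 <;> ring
  have h0 := hent 0 0
  have h1 := hent 1 1
  simp only [loU_val, ex, Matrix.of_apply, Matrix.cons_val, norm_one, one_mul,
    zpow_le_zpow_iff_right₀ one_lt_p] at h0 h1
  obtain rfl : k = m := by omega
  have hle : ∀ i j, ‖(loU x y z : GG p 3).1 i j‖ ≤ 1 := by
    intro i j
    have h2 := hent i j
    by_cases hj : j = 2
    · subst hj
      rw [loU_val]
      fin_cases i <;> simp
    · have h3 : -(ex m (-m) j + ex (-(2 * m)) 0 j) = m := by
        fin_cases j <;> simp [ex] at hj ⊢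
        ring
      rw [h3] at h2
      exact (mul_le_iff_le_one_left (zpow_p_pos _)).mp h2
  obtain ⟨i, hi⟩ := exists_iotaM _ hle (by rw [loU_val, Matrix.det_fin_three]; simp)
  exact ⟨i, by rw [Units.ext hi]⟩

lemma phi_stdFun_self (hl : ∀ x y z v, l (ρ (loU x y z) v) = l v)
    (hχ : ∀ m ∈ Ipre p 3, ρ (redM p 3 m) v₀ = (ξ (diagOf p 3 m) : kb p) • v₀) (m : ℕ) :
    phi l (stdFun ρ ξ v₀ (-m) (-m)) (tt (-(2 * m)) 0) = l v₀ := by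
  have hm : (-m : ℤ) ≤ 0 := by omega
  have h1 : (tt (-m) m : GG p 3) = loU 0 0 0 * tt (-m) (-(-m)) := by
    rw [loU_zero, one_mul, neg_neg]
  let y : loP (p := p) := ⟨tt (-m) m, ⟨_, _, _, _, h1⟩⟩
  rw [phi, finsum_eq_single _ (y : loP (p := p) ⧸ loP₀ (p := p))]
  · rw [map_eq_of_mk_eq hl (indMem_stdFun hχ le_rfl hm) (QuotientGroup.out_eq' _)]
    have h2 : ((y : GG p 3)⁻¹ * tt (-(2 * m)) 0) = tt (-m) (-m) := by
      change (tt (-m) m)⁻¹ * tt (-(2 * m)) 0 = _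
      rw [tt_inv, tt_mul_tt]
      congr 1 <;> ring
    rw [h2, stdFun_tt_self hχ le_rfl hm]
  · intro q hq
    by_contra hne
    refine hq ?_
    obtain ⟨i, hi⟩ := eq_iotaM_mul_tt (ρ := ρ) (ξ := ξ) (v₀ := v₀) (q.out⁻¹).2
      fun h => hne (by rw [← Subgroup.coe_inv, h, map_zero])
    rw [← QuotientGroup.out_eq' q]
    refine QuotientGroup.eq.mpr ⟨i, ?_⟩
    change iotaM p 3 i = ((q.out⁻¹ : loP (p := p)) : GG p 3) * tt (-m) m
    rw [hi, mul_assoc, tt_mul_tt, add_neg_cancel, neg_add_cancel, tt_zero, mul_one]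

lemma coeff_eq_zero_of_mem_phiKer (hl : ∀ x y z v, l (ρ (loU x y z) v) = l v) (hl₀ : l v₀ ≠ 0)
    (hχ : ∀ m ∈ Ipre p 3, ρ (redM p 3 m) v₀ = (ξ (diagOf p 3 m) : kb p) • v₀) (k : ℕ)
    (c : Fin k → kb p)
    (h : (∑ j : Fin k, c j • stdFun ρ ξ v₀ (-(j : ℕ)) (-(j : ℕ))) ∈ phiKer ρ ξ l) (j : Fin k) :
    c j = 0 := by
  have key : ∀ g, ∑ i : Fin k, c i * phi l (stdFun ρ ξ v₀ (-(i : ℕ)) (-(i : ℕ))) g = 0 := by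
    intro g
    rw [← h.2 g, phi_sum _ fun i _ => (indMem_stdFun hχ le_rfl (by omega)).smul _]
    simp only [phi_smul]
  induction hd : k - (j : ℕ) using Nat.strong_induction_on generalizing j with
  | _ d ih =>
    have hj := key (tt (-(2 * (j : ℕ))) 0)
    rw [Finset.sum_eq_single j] at hj
    · rw [phi_stdFun_self hl hχ] at hj
      exact (mul_eq_zero.mp hj).resolve_right hl₀
    · intro i _ hij
      rcases lt_or_gt_of_ne hij with hlt | hgt
      · rw [phi_stdFun_of_lt hlt, mul_zero]
      · rw [ih (k - i) (by omega) i rfl, zero_mul]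
    · exact fun h' => absurd (Finset.mem_univ _) h'

end StableSubspace

/-- there is a nonzero Hecke-stable subspace of the `(IZ, χ_σ)`-isotypic
space of `ind_{KZ}^G σ` of infinite codimension (for `N = 3`). -/
theorem stmt19 (p : ℕ) [Fact p.Prime]
    {V : Type} [AddCommGroup V] [Module (kb p) V] [FiniteDimensional (kb p) V]
    (ρ : Representation (kb p) (Gk p 3) V) (hirr : IsIrred p 3 ρ)
    (v₀ : V) (hv₀ : v₀ ≠ 0)
    (hfix : ∀ m ∈ I1pre p 3, ρ (redM p 3 m) v₀ = v₀)
    (ξ : (Fin 3 → (ZMod p)ˣ) →* (kb p)ˣ)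
    (hχ : ∀ m ∈ Ipre p 3, ρ (redM p 3 m) v₀ = (ξ (diagOf p 3 m) : kb p) • v₀) :
    ∃ M : Set (GG p 3 → V),
      (∀ f ∈ M, IndMem p 3 ρ f ∧ ∀ m ∈ Ipre p 3, ∀ x : GG p 3,
        f (x * iotaM p 3 m) = (ξ (diagOf p 3 m) : kb p) • f x) ∧
      (∃ f ∈ M, f ≠ 0) ∧
      ((0 : GG p 3 → V) ∈ M ∧ (∀ f ∈ M, ∀ g ∈ M, f + g ∈ M) ∧
        ∀ c : kb p, ∀ f ∈ M, c • f ∈ M) ∧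
      (∀ ν : Equiv.Perm (Fin 3), (∀ d, ξ (d ∘ ⇑ν⁻¹) = ξ d) → ∀ b : Fin 2 → ℤ,
        ∀ R : Finset (GG p 3), IsRepSet p 3 (wS p 3 ν b) R →
          ∀ f ∈ M, hk p 3 (wS p 3 ν b) R f ∈ M) ∧
      (∃ e : ℕ → (GG p 3 → V),
        (∀ i : ℕ, IndMem p 3 ρ (e i) ∧ ∀ m ∈ Ipre p 3, ∀ x : GG p 3,
          e i (x * iotaM p 3 m) = (ξ (diagOf p 3 m) : kb p) • e i x) ∧
        ∀ (k : ℕ) (c : Fin k → kb p),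
          (∑ j : Fin k, c j • e (j : ℕ)) ∈ M → ∀ j, c j = 0) := by
  have hU : ∀ x y z, ρ (upU x y z) v₀ = v₀ := by
    intro x y z
    obtain ⟨m, hm⟩ := exists_redM (upU x y z)
    obtain ⟨h1, h2⟩ := Ipre_of_redM (m := m) (d := 1) (x := x) (y := y) (z := z) (by
      rw [hm]
      ext i j
      rw [diU_mul_upU_val]
      fin_cases i <;> fin_cases j <;> simp [upU])
    rw [← hm, hfix m (mem_I1pre_iff.mpr ⟨h1, h2⟩)]
  obtain ⟨l, hl₀, hl⟩ := exists_functional ρ hirr hv₀ hU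
  refine ⟨phiKer ρ ξ l, fun f hf => hf.1, exists_phiKer_ne_zero hχ hv₀ hl,
    ⟨⟨isoMem_zero, phi_zero⟩, fun f hf g hg => ⟨hf.1.add hg.1, fun x => ?_⟩,
      fun c f hf => ⟨hf.1.smul c, fun x => ?_⟩⟩,
    fun ν hν b R hR f hf => ⟨hf.1.hk hν hR, fun x => ?_⟩,
    fun i => stdFun ρ ξ v₀ (-i) (-i), fun i => isoMem_stdFun hχ le_rfl (by omega),
    coeff_eq_zero_of_mem_phiKer hl hl₀ hχ⟩
  · rw [phi_add hf.1.1 hg.1.1, hf.2, hg.2, add_zero]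
  · rw [phi_smul, hf.2, mul_zero]
  · rw [phi_hk hf.1.1]
    exact Finset.sum_eq_zero fun r _ => hf.2 _

end IH
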